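/- arXiv:1307.0192 — 4 statements merged into one kernel-verified Lean document; each statement's English description precedes it below -/
import Mathlib

section
/- For every n ≥ 29, the graph F_n satisfies Sz*(F_n) = (n³ + 2n² − 16)/4 if n is even, and Sz*(F_n) = (n³ + 2n² − 18)/4 if n is odd. -/
attribute [local instance] Classical.propDecidable

noncomputable def nC {V : Type*} [Fintype V] (G : SimpleGraph V) (u v : V) : ℕ :=
  (Finset.univ.filter fun w => G.dist u w < G.dist v w).card

noncomputable def nE {V : Type*} [Fintype V] (G : SimpleGraph V) (u v : V) : ℕ :=
  (Finset.univ.filter fun w => G.dist u w = G.dist v w).card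

lemma nE_comm {V : Type*} [Fintype V] (G : SimpleGraph V) (u v : V) :
    nE G u v = nE G v u := by
  unfold nE; congr 1; ext w; simp [eq_comm]

noncomputable def szContrib {V : Type*} [Fintype V] (G : SimpleGraph V) : Sym2 V → ℚ :=
  Sym2.lift ⟨fun u v =>
    ((nC G u v : ℚ) + (nE G u v : ℚ) / 2) * ((nC G v u : ℚ) + (nE G u v : ℚ) / 2),
    fun u v => by dsimp only; rw [nE_comm]; ring⟩

noncomputable def revSz {V : Type*} [Fintype V] (G : SimpleGraph V) : ℚ :=
  ∑ e ∈ G.edgeFinset, szContrib G e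
/-- Two paths are internally disjoint if every common vertex is an endpoint of both. -/
def IntDisj {V : Type*} {G : SimpleGraph V} {x y x' y' : V}
    (P : G.Walk x y) (Q : G.Walk x' y') : Prop :=
  ∀ v : V, v ∈ P.support → v ∈ Q.support → (v = x ∨ v = y) ∧ (v = x' ∨ v = y')
/-- `G` consists of the four distinct vertices `w, y, x, z`, two internally disjoint
paths `Q₁, Q₂` joining `w` and `y`, two internally disjoint paths `R₁, R₂` joining
`x` and `z`, a path `S` joining `w` and `x`, and a path `T` joining `y` and `z`,
all pairwise internally disjoint, every vertex and every edge of `G` lying on one of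
these paths. -/
def Theta3Cond {V : Type*} (G : SimpleGraph V) (w y x z : V)
    (Q₁ Q₂ : G.Walk w y) (R₁ R₂ : G.Walk x z) (S : G.Walk w x) (T : G.Walk y z) : Prop :=
  w ≠ y ∧ w ≠ x ∧ w ≠ z ∧ y ≠ x ∧ y ≠ z ∧ x ≠ z ∧
  Q₁.IsPath ∧ Q₂.IsPath ∧ R₁.IsPath ∧ R₂.IsPath ∧ S.IsPath ∧ T.IsPath ∧
  Q₁ ≠ Q₂ ∧ R₁ ≠ R₂ ∧
  IntDisj Q₁ Q₂ ∧ IntDisj Q₁ R₁ ∧ IntDisj Q₁ R₂ ∧ IntDisj Q₁ S ∧ IntDisj Q₁ T ∧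
  IntDisj Q₂ R₁ ∧ IntDisj Q₂ R₂ ∧ IntDisj Q₂ S ∧ IntDisj Q₂ T ∧
  IntDisj R₁ R₂ ∧ IntDisj R₁ S ∧ IntDisj R₁ T ∧
  IntDisj S T ∧ IntDisj R₂ S ∧ IntDisj R₂ T ∧
  (∀ v : V, v ∈ Q₁.support ∨ v ∈ Q₂.support ∨ v ∈ R₁.support ∨ v ∈ R₂.support ∨
    v ∈ S.support ∨ v ∈ T.support) ∧
  (∀ e ∈ G.edgeSet, e ∈ Q₁.edges ∨ e ∈ Q₂.edges ∨ e ∈ R₁.edges ∨ e ∈ R₂.edges ∨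
    e ∈ S.edges ∨ e ∈ T.edges)

/-- `G` is a Θ₃-graph. -/
def IsTheta3 {V : Type*} (G : SimpleGraph V) : Prop :=
  ∃ (w y x z : V) (Q₁ Q₂ : G.Walk w y) (R₁ R₂ : G.Walk x z) (S : G.Walk w x)
    (T : G.Walk y z), Theta3Cond G w y x z Q₁ Q₂ R₁ R₂ S T

/-- `G` is the Θ₃-graph in which the two paths joining `w` and `y` have length 2,
the two paths joining `x` and `z` have length 2, the path joining `w` and `x` has
length `a` and the path joining `y` and `z` has length `b`, where `a + b + 6 = n`,
`0 < a`, and `b = a + 2` if `n` is even, `b = a + 3` if `n` is odd; i.e. `G ≅ Fₙ`. -/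
def IsFGraph {V : Type*} (n : ℕ) (G : SimpleGraph V) : Prop :=
  ∃ (a b : ℕ), 0 < a ∧ 0 < b ∧ a + b + 6 = n ∧
    (if Even n then b = a + 2 else b = a + 3) ∧
    ∃ (w y x z : V) (Q₁ Q₂ : G.Walk w y) (R₁ R₂ : G.Walk x z) (S : G.Walk w x)
      (T : G.Walk y z), Theta3Cond G w y x z Q₁ Q₂ R₁ R₂ S T ∧
      Q₁.length = 2 ∧ Q₂.length = 2 ∧ R₁.length = 2 ∧ R₂.length = 2 ∧
      S.length = a ∧ T.length = b

namespace ThetaCycle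

/-- A function satisfying the local characterization of the distance is the distance. -/
lemma dist_eq_of_local {V : Type*} {G : SimpleGraph V} {D : V → V → ℕ}
    (h0 : ∀ u, D u u = 0) (hadj : ∀ u v w, G.Adj u v → D u w ≤ D v w + 1)
    (hstep : ∀ u w, u ≠ w → ∃ v, G.Adj u v ∧ D u w = D v w + 1) (u w : V) :
    G.dist u w = D u w := by
  have lower : ∀ {u w} (p : G.Walk u w), D u w ≤ p.length := by
    intro u w p
    induction p with
    | nil => simp [h0]
    | cons h p ih =>
      have := hadj _ _ _ h |>.trans (Nat.succ_le_succ ih)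
      simpa using this
  have upper : ∀ k u w, D u w = k → ∃ p : G.Walk u w, p.length = k := by
    intro k
    induction k with
    | zero =>
      intro u w h
      by_cases huw : u = w
      · subst huw
        exact ⟨.nil, rfl⟩
      · obtain ⟨v, -, hv⟩ := hstep u w huw
        omega
    | succ k ih =>
      intro u w h
      have huw : u ≠ w := by
        rintro rfl
        simp [h0] at h
      obtain ⟨v, hv, hd⟩ := hstep u w huw
      obtain ⟨p, hp⟩ := ih v w (by omega)
      exact ⟨.cons hv p, by simp [hp]⟩
  obtain ⟨p, hp⟩ := upper _ u w rfl
  obtain ⟨q, hq⟩ := SimpleGraph.Reachable.exists_walk_length_eq_dist ⟨p⟩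
  have h1 := lower q
  have h2 := SimpleGraph.dist_le p
  omega

/-- The distance in the cycle of length `L` between the positions `x` and `y`. -/
def cyc (L x y : ℕ) : ℕ := min ((x - y) + (y - x)) (L - ((x - y) + (y - x)))

/-- The position on the cycle of length `L`: the labels `L` and `L + 1` are twins of the
positions `0` and `r`. -/
noncomputable def pos (L r i : ℕ) : ℕ := if i < L then i else if i = L then 0 else r

/-- The distance in the cycle of length `L` with the vertices `0` and `r` duplicated. -/
noncomputable def tdist (L r i j : ℕ) : ℕ :=
  if i = j then 0 else if pos L r i = pos L r j then 2 else cyc L (pos L r i) (pos L r j)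

/-- `y` is the successor of `x` on the cycle of length `L`. -/
def Nxt (L x y : ℕ) : Prop := y = x + 1 ∨ x + 1 = L ∧ y = 0

/-- The `t`-th edge of the cycle of length `L` with `0` and `r` duplicated, oriented along
the cycle. -/
noncomputable def edg (L r t : ℕ) : ℕ × ℕ :=
  if t + 1 < L then (t, t + 1) else if t + 1 = L then (t, 0) else
  if t = L then (L, 1) else if t = L + 1 then (L - 1, L) else
  if t = L + 2 then (L + 1, r + 1) else (r - 1, L + 1)

lemma pos_lt {L r i : ℕ} (hr : r < L) : pos L r i < L := by
  unfold pos; split_ifs <;> omega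

lemma cyc_nxt {L x y z : ℕ} (hx : x < L) (hy : y < L) (hz : z < L) (h : Nxt L x y) :
    cyc L x z ≤ cyc L y z + 1 ∧ cyc L y z ≤ cyc L x z + 1 := by
  unfold cyc; unfold Nxt at h; omega

lemma cyc_eq_zero {L x y : ℕ} (hx : x < L) (hy : y < L) : cyc L x y = 0 ↔ x = y := by
  unfold cyc; omega

lemma cyc_self (L x : ℕ) : cyc L x x = 0 := by
  unfold cyc; omega

lemma cyc_eq_one {L x y : ℕ} (hL : 3 ≤ L) (hx : x < L) (hy : y < L) :
    cyc L x y = 1 ↔ Nxt L x y ∨ Nxt L y x := by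
  unfold cyc Nxt; omega

lemma exists_cyc_step {L x y : ℕ} (hL : 3 ≤ L) (hx : x < L) (hy : y < L) (h : x ≠ y) :
    ∃ z < L, (Nxt L x z ∨ Nxt L z x) ∧ cyc L x y = cyc L z y + 1 := by
  by_cases hf : cyc L x y = cyc L (if x + 1 = L then 0 else x + 1) y + 1
  · refine ⟨_, ?_, ?_, hf⟩
    · split_ifs <;> omega
    · unfold Nxt; split_ifs <;> omega
  · refine ⟨if x = 0 then L - 1 else x - 1, ?_, ?_, ?_⟩
    · split_ifs <;> omega
    · unfold Nxt; split_ifs <;> omega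
    · unfold cyc at *; split_ifs at * <;> omega

lemma edg_fst_lt {L r t : ℕ} (hr : 2 ≤ r) (hrL : r + 2 ≤ L) :
    (edg L r t).1 < L + 2 := by
  unfold edg; split_ifs <;> dsimp only <;> omega

lemma edg_snd_lt {L r t : ℕ} (hrL : r + 2 ≤ L) :
    (edg L r t).2 < L + 2 := by
  unfold edg; split_ifs <;> dsimp only <;> omega

lemma nxt_edg {L r t : ℕ} (hr : 2 ≤ r) (hrL : r + 2 ≤ L) :
    Nxt L (pos L r (edg L r t).1) (pos L r (edg L r t).2) := by
  unfold edg Nxt pos; split_ifs <;> dsimp only at * <;> omega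

lemma exists_edg {L r i j : ℕ} (hr : 2 ≤ r) (hrL : r + 2 ≤ L) (hi : i < L + 2) (hj : j < L + 2)
    (h : Nxt L (pos L r i) (pos L r j)) : ∃ t < L + 4, edg L r t = (i, j) := by
  obtain ⟨t, ht⟩ : ∃ t, t = if i = L then L else if j = L then L + 1 else
    if i = L + 1 then L + 2 else if j = L + 1 then L + 3 else i := ⟨_, rfl⟩
  have htL : t < L + 4 := by split_ifs at ht <;> omega
  refine ⟨t, htL, ?_⟩
  unfold Nxt pos at h
  unfold edg
  split_ifs at h <;> split_ifs at ht <;> split_ifs <;>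
    (try rw [false_or] at h) <;> simp only [Prod.mk.injEq] <;> omega

lemma nxt_asymm {L x y : ℕ} (hL : 3 ≤ L) (h : Nxt L x y) : ¬ Nxt L y x := by
  unfold Nxt at *; omega

lemma edg_injOn {L r : ℕ} (hr : 2 ≤ r) (hrL : r + 2 ≤ L) {s t : ℕ} (hs : s < L + 4)
    (ht : t < L + 4) (h : edg L r s = edg L r t) : s = t := by
  unfold edg at h
  split_ifs at h <;> simp only [Prod.mk.injEq] at h <;> omega

lemma tdist_self (L r i : ℕ) : tdist L r i i = 0 := by simp [tdist]

lemma tdist_le_of_nxt {L r i j k : ℕ} (hr : 2 ≤ r) (hrL : r + 2 ≤ L)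
    (h : Nxt L (pos L r i) (pos L r j)) :
    tdist L r i k ≤ tdist L r j k + 1 ∧ tdist L r j k ≤ tdist L r i k + 1 := by
  have hr' : r < L := by omega
  have hi := pos_lt (i := i) hr'
  have hj := pos_lt (i := j) hr'
  have hk := pos_lt (i := k) hr'
  have h1 := cyc_nxt hi hj hk h
  have h2 := cyc_self L (pos L r k)
  have h3 := cyc_nxt hi hj hi h
  have h4 := cyc_nxt hi hj hj h
  have h5 := cyc_self L (pos L r i)
  have h6 := cyc_self L (pos L r j)
  have h7 := cyc_eq_zero hi hk
  have h8 := cyc_eq_zero hj hk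
  have hne : pos L r i ≠ pos L r j := by unfold Nxt at h; omega
  unfold tdist
  split_ifs <;> subst_vars <;> simp_all <;> omega

lemma exists_tdist_step {L r i k : ℕ} (hr : 2 ≤ r) (hrL : r + 2 ≤ L)
    (hk : k < L + 2) (hik : i ≠ k) :
    ∃ j < L + 2, (Nxt L (pos L r i) (pos L r j) ∨ Nxt L (pos L r j) (pos L r i)) ∧
      tdist L r i k = tdist L r j k + 1 := by
  have hr' : r < L := by omega
  have hpi := pos_lt (i := i) hr'
  have hpk := pos_lt (i := k) hr'
  by_cases hp : pos L r i = pos L r k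
  · have hz : ∃ z < L, Nxt L (pos L r i) z := by
      unfold Nxt
      by_cases h : pos L r i + 1 = L
      · exact ⟨0, by omega, by omega⟩
      · exact ⟨_, by omega, Or.inl rfl⟩
    obtain ⟨z, hz, hn⟩ := hz
    have hpz : pos L r z = z := by simp [pos, hz]
    refine ⟨z, by omega, Or.inl (by rwa [hpz]), ?_⟩
    have h1 : cyc L z (pos L r k) = 1 :=
      (cyc_eq_one (by omega) hz hpk).2 (Or.inr (by rwa [← hp]))
    have h2 : z ≠ pos L r k := by
      intro h; rw [h, cyc_self] at h1; omega
    have h3 : z ≠ k := by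
      rintro rfl; exact h2 hpz.symm
    simp [tdist, hik, hp, hpz, h2, h3, h1]
  · obtain ⟨z, hz, hn, hd⟩ := exists_cyc_step (by omega) hpi hpk hp
    have hpz : pos L r z = z := by simp [pos, hz]
    by_cases hzk : z = pos L r k
    · refine ⟨k, hk, by rwa [← hzk], ?_⟩
      rw [hzk, cyc_self] at hd
      simp [tdist, hik, hp, hd]
    · refine ⟨z, by omega, by rwa [hpz], ?_⟩
      have h3 : z ≠ k := by
        rintro rfl; exact hzk hpz.symm
      simp [tdist, hik, hp, hd, hpz, hzk, h3]

/-- The sign of `y - x`. -/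
noncomputable def cmpSgn (x y : ℕ) : ℤ := (if x < y then 1 else 0) - (if y < x then 1 else 0)

lemma nC_sub_nC {V : Type*} [Fintype V] (G : SimpleGraph V) (u v : V) :
    (nC G u v : ℤ) - nC G v u = ∑ w, cmpSgn (G.dist u w) (G.dist v w) := by
  simp [nC, cmpSgn, Finset.sum_sub_distrib]

lemma nC_add_nC_add_nE {V : Type*} [Fintype V] (G : SimpleGraph V) (u v : V) :
    nC G u v + nC G v u + nE G u v = Fintype.card V := by
  simp only [nC, nE, Finset.card_filter, ← Finset.sum_add_distrib, Fintype.card_eq_sum_ones]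
  refine Finset.sum_congr rfl fun w _ => ?_
  split_ifs <;> omega

lemma szContrib_mk {V : Type*} [Fintype V] (G : SimpleGraph V) (u v : V) :
    szContrib G s(u, v) = ((Fintype.card V : ℚ) ^ 2 -
      ((∑ w, cmpSgn (G.dist u w) (G.dist v w) : ℤ) : ℚ) ^ 2) / 4 := by
  rw [← nC_sub_nC, ← nC_add_nC_add_nE G u v]
  simp only [szContrib, Sym2.lift_mk]
  push_cast
  ring

/-- The difference of the numbers of labels closer to `i` and closer to `j`. -/
noncomputable def tdiff (L r i j : ℕ) : ℤ :=
  ∑ k ∈ Finset.range (L + 2), cmpSgn (tdist L r i k) (tdist L r j k)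

lemma tdist_of_lt {L r i k : ℕ} (hk : k < L) :
    tdist L r i k = if L ≤ i ∧ k = pos L r i then 2 else cyc L (pos L r i) k := by
  have hpk : pos L r k = k := by simp [pos, hk]
  by_cases hi : i < L
  · have hpi : pos L r i = i := by simp [pos, hi]
    simp only [tdist, hpk, hpi, not_le.2 hi, false_and, if_false]
    split_ifs with h
    · rw [h, cyc_self]
    · rfl
  · have hik : i ≠ k := by omega
    simp [tdist, hik, hpk, not_lt.1 hi, eq_comm]

lemma sum_cmpSgn_cyc {L x y : ℕ} (hL : 3 ≤ L) (hx : x < L) (h : Nxt L x y) :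
    ∑ k ∈ Finset.range L, cmpSgn (cyc L x k) (cyc L y k) = 0 := by
  let ρ : ℕ → ℕ := fun k => if k ≤ 2 * x + 1 then
    (if 2 * x + 1 - k < L then 2 * x + 1 - k else 2 * x + 1 - k - L) else 2 * x + 1 + L - k
  have h1 : ∀ k < L, ρ k < L := by
    intro k hk; dsimp only [ρ]; split_ifs <;> omega
  have h2 : ∀ k < L, ρ (ρ k) = k := by
    intro k hk; dsimp only [ρ]; split_ifs <;> omega
  have h3 : ∀ k < L, cyc L x (ρ k) = cyc L y k := by
    intro k hk; unfold Nxt at h; dsimp only [ρ]; unfold cyc; split_ifs <;> omega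
  have h4 : ∀ k < L, cyc L y (ρ k) = cyc L x k := by
    intro k hk
    rw [← h3 _ (h1 k hk), h2 k hk]
  have h5 : ∀ k < L, cmpSgn (cyc L x k) (cyc L y k) +
      cmpSgn (cyc L x (ρ k)) (cyc L y (ρ k)) = 0 := by
    intro k hk
    rw [h3 k hk, h4 k hk]
    unfold cmpSgn; ring
  refine Finset.sum_involution (fun k _ => ρ k) ?_ ?_ ?_ ?_
  · exact fun k hk => h5 k (Finset.mem_range.1 hk)
  · intro k hk hne heq
    have := h5 k (Finset.mem_range.1 hk)
    rw [heq] at this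
    omega
  · exact fun k hk => Finset.mem_range.2 (h1 k (Finset.mem_range.1 hk))
  · exact fun k hk => h2 k (Finset.mem_range.1 hk)

lemma tdiff_eq {L r i j : ℕ} (hr : 2 ≤ r) (hrL : r + 2 ≤ L)
    (h : Nxt L (pos L r i) (pos L r j)) :
    tdiff L r i j = (if i < L then 0 else -2) + (if j < L then 0 else 2) +
      cmpSgn (tdist L r i L) (tdist L r j L) +
      cmpSgn (tdist L r i (L + 1)) (tdist L r j (L + 1)) := by
  have hpi := pos_lt (i := i) (by omega : r < L)
  have hpj := pos_lt (i := j) (by omega : r < L)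
  have hij : cyc L (pos L r i) (pos L r j) = 1 := (cyc_eq_one (by omega) hpi hpj).2 (.inl h)
  have hji : cyc L (pos L r j) (pos L r i) = 1 := (cyc_eq_one (by omega) hpj hpi).2 (.inr h)
  have hne : pos L r i ≠ pos L r j := by
    intro h0; rw [h0, cyc_self] at hij; omega
  have hsum : ∑ k ∈ Finset.range L, cmpSgn (tdist L r i k) (tdist L r j k) =
      ∑ k ∈ Finset.range L, (cmpSgn (cyc L (pos L r i) k) (cyc L (pos L r j) k) +
        (if k = pos L r i then (if i < L then 0 else -2) else 0) +
        (if k = pos L r j then (if j < L then 0 else 2) else 0)) := by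
    refine Finset.sum_congr rfl fun k hk => ?_
    rw [tdist_of_lt (Finset.mem_range.1 hk), tdist_of_lt (Finset.mem_range.1 hk)]
    by_cases h1 : k = pos L r i
    · subst h1
      by_cases hi : i < L <;> simp [hi, hne, hji, cyc_self, cmpSgn, not_le.2, not_lt.1]
    · by_cases h2 : k = pos L r j
      · subst h2
        by_cases hj : j < L <;> simp [hj, hne.symm, hij, cyc_self, cmpSgn, not_le.2, not_lt.1]
      · simp [h1, h2]
  rw [tdiff, Finset.sum_range_succ, Finset.sum_range_succ, hsum, Finset.sum_add_distrib,
    Finset.sum_add_distrib, sum_cmpSgn_cyc (by omega) hpi h, Finset.sum_ite_eq',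
    Finset.sum_ite_eq']
  simp [hpi, hpj]

/-- The revised Szeged index of `G` when `c` labels the vertices of `G` along a
cycle with two duplicated vertices. -/
lemma revSz_eq_of_label {V : Type*} [Fintype V] {G : SimpleGraph V} {L r : ℕ} (c : ℕ → V)
    (hr : 2 ≤ r) (hrL : r + 2 ≤ L) (hcard : Fintype.card V = L + 2)
    (hsurj : ∀ v, ∃ i < L + 2, c i = v)
    (hadj : ∀ t < L + 4, G.Adj (c (edg L r t).1) (c (edg L r t).2))
    (hedge : ∀ e ∈ G.edgeSet, ∃ t < L + 4, e = s(c (edg L r t).1, c (edg L r t).2)) :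
    revSz G = ((L + 4 : ℚ) * (L + 2) ^ 2 -
      ((∑ t ∈ Finset.range (L + 4), tdiff L r (edg L r t).1 (edg L r t).2 ^ 2 : ℤ) : ℚ)) / 4 := by
  have hbij : Function.Bijective fun i : Fin (L + 2) => c i := by
    refine (Fintype.bijective_iff_surjective_and_card _).2 ⟨fun v => ?_, by simp [hcard]⟩
    obtain ⟨i, hi, rfl⟩ := hsurj v
    exact ⟨⟨i, hi⟩, rfl⟩
  have hinj : ∀ i < L + 2, ∀ j < L + 2, c i = c j → i = j := by
    intro i hi j hj hc
    have := @hbij.1 ⟨i, hi⟩ ⟨j, hj⟩ hc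
    simpa using this
  have hAdj : ∀ i < L + 2, ∀ j < L + 2, (G.Adj (c i) (c j) ↔
      Nxt L (pos L r i) (pos L r j) ∨ Nxt L (pos L r j) (pos L r i)) := by
    intro i hi j hj
    constructor
    · intro h
      obtain ⟨t, -, ht⟩ := hedge s(c i, c j) h
      have hn := nxt_edg (t := t) hr hrL
      have hfst := edg_fst_lt (t := t) hr hrL
      have hsnd := edg_snd_lt (r := r) (t := t) hrL
      rcases Sym2.eq_iff.1 ht with ⟨h1, h2⟩ | ⟨h1, h2⟩
      · rw [hinj i hi _ hfst h1, hinj j hj _ hsnd h2]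
        exact .inl hn
      · rw [hinj i hi _ hsnd h1, hinj j hj _ hfst h2]
        exact .inr hn
    · rintro (h | h)
      · obtain ⟨t, ht, he⟩ := exists_edg hr hrL hi hj h
        simpa [he] using hadj t ht
      · obtain ⟨t, ht, he⟩ := exists_edg hr hrL hj hi h
        simpa [he] using (hadj t ht).symm
  let e : Fin (L + 2) ≃ V := Equiv.ofBijective _ hbij
  have hc : ∀ u, c (e.symm u) = u := fun u => e.apply_symm_apply u
  have hsymm : ∀ i (hi : i < L + 2), e.symm (c i) = ⟨i, hi⟩ := fun i hi =>
    e.symm_apply_apply ⟨i, hi⟩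
  have hdist : ∀ i < L + 2, ∀ j < L + 2, G.dist (c i) (c j) = tdist L r i j := by
    intro i hi j hj
    rw [dist_eq_of_local (D := fun u v => tdist L r (e.symm u) (e.symm v))]
    · simp [hsymm, hi, hj]
    · exact fun u => tdist_self _ _ _
    · intro u v w h
      rw [← hc u, ← hc v, hAdj _ (e.symm u).2 _ (e.symm v).2] at h
      rcases h with h | h
      · exact (tdist_le_of_nxt hr hrL h).1
      · exact (tdist_le_of_nxt hr hrL h).2
    · intro u w h
      obtain ⟨k, hk, hn, hd⟩ := exists_tdist_step hr hrL (e.symm w).2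
        (i := e.symm u) (by simpa [Fin.val_inj] using h)
      refine ⟨c k, ?_, ?_⟩
      · rw [← hAdj _ (e.symm u).2 _ hk, hc] at hn
        exact hn
      · simpa [hsymm, hk] using hd
  have hcontrib : ∀ i < L + 2, ∀ j < L + 2, szContrib G s(c i, c j) =
      ((L + 2 : ℚ) ^ 2 - (tdiff L r i j : ℚ) ^ 2) / 4 := by
    intro i hi j hj
    rw [szContrib_mk, hcard, ← e.sum_comp, tdiff, Finset.sum_range]
    have : ∀ k : Fin (L + 2), cmpSgn (G.dist (c i) (e k)) (G.dist (c j) (e k)) =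
        cmpSgn (tdist L r i k) (tdist L r j k) := by
      intro k
      rw [← hdist i hi k k.2, ← hdist j hj k k.2]
      rfl
    simp [this]
  have himage : G.edgeFinset = (Finset.range (L + 4)).image
      fun t => s(c (edg L r t).1, c (edg L r t).2) := by
    ext x
    simp only [SimpleGraph.mem_edgeFinset, Finset.mem_image, Finset.mem_range]
    constructor
    · intro hx
      obtain ⟨t, ht, rfl⟩ := hedge x hx
      exact ⟨t, ht, rfl⟩
    · rintro ⟨t, ht, rfl⟩
      exact hadj t ht
  rw [revSz, himage, Finset.sum_image]
  · rw [Finset.sum_congr rfl fun t _ => hcontrib _ (edg_fst_lt hr hrL) _ (edg_snd_lt hrL),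
      ← Finset.sum_div, Finset.sum_sub_distrib]
    simp
  · intro s hs t ht h
    have hs1 := edg_fst_lt (t := s) hr hrL
    have hs2 := edg_snd_lt (r := r) (t := s) hrL
    have ht1 := edg_fst_lt (t := t) hr hrL
    have ht2 := edg_snd_lt (r := r) (t := t) hrL
    rcases Sym2.eq_iff.1 h with ⟨h1, h2⟩ | ⟨h1, h2⟩
    · exact edg_injOn hr hrL (by simpa using hs) (by simpa using ht)
        (Prod.ext (hinj _ hs1 _ ht1 h1) (hinj _ hs2 _ ht2 h2))
    · have hns := nxt_edg (t := s) hr hrL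
      have hnt := nxt_edg (t := t) hr hrL
      rw [hinj _ hs1 _ ht2 h1, hinj _ hs2 _ ht1 h2] at hns
      exact absurd hnt (nxt_asymm (by omega) hns)

/-- The contribution of a vertex at position `p` and of its twin to `tdiff` along the cycle
edge from `i` to its successor, where `i` lies `δ` steps after `p`. -/
noncomputable def twinSgn (L δ : ℕ) : ℤ :=
  if δ = 0 ∨ (L < 2 * δ + 1 ∧ δ + 1 < L) then -1 else if 2 * δ + 1 = L then 0 else 1

lemma cmpSgn_cyc_twin {L p i j δ : ℕ} (hL : 4 ≤ L) (hp : p < L) (hi : i < L) (hj : j < L)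
    (hδ : δ < L) (hi' : i = p + δ ∨ i + L = p + δ) (h : Nxt L i j) :
    cmpSgn (if i = p then 2 else cyc L i p) (if j = p then 2 else cyc L j p) =
      twinSgn L δ := by
  by_cases h1 : i = p
  · have h2 : cyc L j p = 1 := (cyc_eq_one (by omega) hj hp).2 (.inr (h1 ▸ h))
    have h3 : j ≠ p := by rintro rfl; rw [cyc_self] at h2; omega
    rw [if_pos h1, if_neg h3, h2, show cmpSgn 2 1 = -1 by simp [cmpSgn], twinSgn,
      if_pos (by omega)]
  by_cases h2 : j = p
  · have h3 : cyc L i p = 1 := (cyc_eq_one (by omega) hi hp).2 (.inl (h2 ▸ h))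
    unfold Nxt at h
    rw [if_neg h1, if_pos h2, h3, show cmpSgn 1 2 = 1 by simp [cmpSgn], twinSgn,
      if_neg (by omega), if_neg (by omega)]
  rw [if_neg h1, if_neg h2]
  have h3 : cyc L i p = min δ (L - δ) := by unfold cyc; omega
  have h4 : cyc L j p = min (δ + 1) (L - (δ + 1)) := by unfold Nxt at h; unfold cyc; omega
  have h5 : δ + 1 ≠ L := by unfold Nxt at h; omega
  rw [h3, h4]
  unfold cmpSgn twinSgn
  split_ifs <;> omega

lemma tdiff_cycle_edge {L r t : ℕ} (hr : 2 ≤ r) (hrL : r + 2 ≤ L) (ht : t < L) :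
    tdiff L r (edg L r t).1 (edg L r t).2 =
      twinSgn L t + twinSgn L (if r ≤ t then t - r else t + L - r) := by
  have hn := nxt_edg (t := t) hr hrL
  rw [tdiff_eq hr hrL hn]
  have he : (edg L r t).1 = t := by unfold edg; split_ifs <;> first | rfl | omega
  have hs : (edg L r t).2 < L := by unfold edg; split_ifs <;> dsimp only <;> omega
  have hpos : ∀ i < L, pos L r i = i := fun i hi => by simp [pos, hi]
  rw [he, hpos _ ht, hpos _ hs] at hn
  have h0 : ∀ i < L, tdist L r i L = if i = 0 then 2 else cyc L i 0 := by
    intro i hi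
    simp [tdist, pos, hi, hi.ne]
  have h1 : ∀ i < L, tdist L r i (L + 1) = if i = r then 2 else cyc L i r := by
    intro i hi
    simp [tdist, pos, hi, (show i ≠ L + 1 by omega)]
  rw [he, if_pos ht, if_pos hs, h0 _ ht, h0 _ hs, h1 _ ht, h1 _ hs, add_zero, zero_add,
    cmpSgn_cyc_twin (δ := t) (by omega) (by omega) ht hs ht (by omega) hn,
    cmpSgn_cyc_twin (δ := if r ≤ t then t - r else t + L - r) (by omega) (by omega) ht hs
      (by split_ifs <;> omega) (by split_ifs <;> omega) hn]

lemma tdiff_twin_edges {L r : ℕ} (hr : 3 ≤ r) (hrL : 2 * (r + 1) ≤ L) (hLr : L ≤ 2 * r + 3) :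
    tdiff L r (edg L r L).1 (edg L r L).2 = -2 ∧
    tdiff L r (edg L r (L + 1)).1 (edg L r (L + 1)).2 = 0 ∧
    tdiff L r (edg L r (L + 2)).1 (edg L r (L + 2)).2 = 0 ∧
    tdiff L r (edg L r (L + 3)).1 (edg L r (L + 3)).2 = 2 := by
  have e0 : edg L r L = (L, 1) := by simp [edg]
  have e1 : edg L r (L + 1) = (L - 1, L) := by unfold edg; split_ifs <;> first | rfl | omega
  have e2 : edg L r (L + 2) = (L + 1, r + 1) := by
    unfold edg; split_ifs <;> first | rfl | omega
  have e3 : edg L r (L + 3) = (r - 1, L + 1) := by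
    unfold edg; split_ifs <;> first | rfl | omega
  have d0 : tdist L r L (L + 1) = r := by unfold tdist pos cyc; split_ifs <;> omega
  have d1 : tdist L r (L + 1) L = r := by unfold tdist pos cyc; split_ifs <;> omega
  have d2 : tdist L r 1 L = 1 := by
    unfold tdist pos cyc; split_ifs <;> first | omega | contradiction
  have d3 : tdist L r 1 (L + 1) = r - 1 := by unfold tdist pos cyc; split_ifs <;> omega
  have d4 : tdist L r (L - 1) L = 1 := by unfold tdist pos cyc; split_ifs <;> omega
  have d5 : tdist L r (L - 1) (L + 1) = r + 1 := by unfold tdist pos cyc; split_ifs <;> omega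
  have d6 : tdist L r (r + 1) L = r + 1 := by
    unfold tdist pos cyc; split_ifs <;> first | omega | contradiction
  have d7 : tdist L r (r + 1) (L + 1) = 1 := by unfold tdist pos cyc; split_ifs <;> omega
  have d8 : tdist L r (r - 1) L = r - 1 := by unfold tdist pos cyc; split_ifs <;> omega
  have d9 : tdist L r (r - 1) (L + 1) = 1 := by unfold tdist pos cyc; split_ifs <;> omega
  refine ⟨?_, ?_, ?_, ?_⟩ <;>
    rw [tdiff_eq (by omega) (by omega) (nxt_edg (by omega) (by omega))] <;>
    simp only [e0, e1, e2, e3, d0, d1, d2, d3, d4, d5, d6, d7, d8, d9, tdist_self, cmpSgn] <;>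
    split_ifs <;> omega

lemma sum_tdiff_sq_even {r : ℕ} (hr : 3 ≤ r) :
    ∑ t ∈ Finset.range (2 * (r + 1) + 4),
      tdiff (2 * (r + 1)) r (edg (2 * (r + 1)) r t).1 (edg (2 * (r + 1)) r t).2 ^ 2 = 16 := by
  obtain ⟨h0, h1, h2, h3⟩ := tdiff_twin_edges hr le_rfl (by omega : 2 * (r + 1) ≤ 2 * r + 3)
  have hcyc : ∀ t ∈ Finset.range (2 * (r + 1)),
      tdiff (2 * (r + 1)) r (edg (2 * (r + 1)) r t).1 (edg (2 * (r + 1)) r t).2 ^ 2 =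
      (if t = 0 then 4 else 0) + (if t = r - 1 then 4 else 0) := by
    intro t ht
    rw [Finset.mem_range] at ht
    rw [tdiff_cycle_edge (by omega) (by omega) ht]
    have key : ∀ x : ℤ, x = (if t = 0 then -2 else 0) + (if t = r - 1 then 2 else 0) →
        x ^ 2 = (if t = 0 then 4 else 0) + (if t = r - 1 then 4 else 0) := by
      rintro x rfl
      split_ifs <;> omega
    apply key
    unfold twinSgn
    split_ifs <;> omega
  rw [Finset.sum_range_succ, Finset.sum_range_succ, Finset.sum_range_succ,
    Finset.sum_range_succ, Finset.sum_congr rfl hcyc, Finset.sum_add_distrib,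
    Finset.sum_ite_eq', Finset.sum_ite_eq', h0, h1, h2, h3,
    if_pos (Finset.mem_range.2 (by omega)), if_pos (Finset.mem_range.2 (by omega))]
  norm_num

lemma sum_tdiff_sq_odd {r : ℕ} (hr : 3 ≤ r) :
    ∑ t ∈ Finset.range (2 * r + 3 + 4),
      tdiff (2 * r + 3) r (edg (2 * r + 3) r t).1 (edg (2 * r + 3) r t).2 ^ 2 = 18 := by
  obtain ⟨h0, h1, h2, h3⟩ := tdiff_twin_edges hr (by omega : 2 * (r + 1) ≤ 2 * r + 3) le_rfl
  have hcyc : ∀ t ∈ Finset.range (2 * r + 3),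
      tdiff (2 * r + 3) r (edg (2 * r + 3) r t).1 (edg (2 * r + 3) r t).2 ^ 2 =
      (if t = 0 then 4 else 0) + (if t = r - 1 then 4 else 0) +
      (if t = r + 1 then 1 else 0) + (if t = 2 * r + 1 then 1 else 0) := by
    intro t ht
    rw [Finset.mem_range] at ht
    rw [tdiff_cycle_edge (by omega) (by omega) ht]
    have key : ∀ x : ℤ, x = (if t = 0 then -2 else 0) + (if t = r - 1 then 2 else 0) +
        (if t = r + 1 then 1 else 0) + (if t = 2 * r + 1 then -1 else 0) →
        x ^ 2 = (if t = 0 then 4 else 0) + (if t = r - 1 then 4 else 0) +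
          (if t = r + 1 then 1 else 0) + (if t = 2 * r + 1 then 1 else 0) := by
      rintro x rfl
      split_ifs <;> omega
    apply key
    unfold twinSgn
    split_ifs <;> omega
  rw [Finset.sum_range_succ, Finset.sum_range_succ, Finset.sum_range_succ,
    Finset.sum_range_succ, Finset.sum_congr rfl hcyc, Finset.sum_add_distrib,
    Finset.sum_add_distrib, Finset.sum_add_distrib, Finset.sum_ite_eq', Finset.sum_ite_eq',
    Finset.sum_ite_eq', Finset.sum_ite_eq', h0, h1, h2, h3,
    if_pos (Finset.mem_range.2 (by omega)), if_pos (Finset.mem_range.2 (by omega)),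
    if_pos (Finset.mem_range.2 (by omega)), if_pos (Finset.mem_range.2 (by omega))]
  norm_num

/-- The labelling of the vertices of a Θ₃-graph along a cycle through the interior vertices
of `Q₁` and `R₁`, the interior vertices of `Q₂` and `R₂` coming last. -/
noncomputable def label {V : Type*} {G : SimpleGraph V} {w y x z : V} (a L : ℕ)
    (Q₁ Q₂ : G.Walk w y) (R₁ R₂ : G.Walk x z) (S : G.Walk w x) (T : G.Walk y z) (i : ℕ) : V :=
  if i = 0 then Q₁.getVert 1 else if i ≤ a + 1 then S.getVert (i - 1) else
  if i = a + 2 then R₁.getVert 1 else if i < L then T.getVert (L - 1 - i) else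
  if i = L then Q₂.getVert 1 else R₂.getVert 1

lemma revSz_of_theta {V : Type*} [Fintype V] {G : SimpleGraph V} {w y x z : V} {a b : ℕ}
    {Q₁ Q₂ : G.Walk w y} {R₁ R₂ : G.Walk x z} {S : G.Walk w x} {T : G.Walk y z}
    (hcard : Fintype.card V = a + b + 6) (hΘ : Theta3Cond G w y x z Q₁ Q₂ R₁ R₂ S T)
    (hQ₁ : Q₁.length = 2) (hQ₂ : Q₂.length = 2) (hR₁ : R₁.length = 2) (hR₂ : R₂.length = 2)
    (hS : S.length = a) (hT : T.length = b) (ha : 0 < a) (hb : 0 < b) :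
    revSz G = (((a + b + 4 : ℕ) + 4 : ℚ) * ((a + b + 4 : ℕ) + 2) ^ 2 -
      ((∑ t ∈ Finset.range (a + b + 4 + 4), tdiff (a + b + 4) (a + 2)
        (edg (a + b + 4) (a + 2) t).1 (edg (a + b + 4) (a + 2) t).2 ^ 2 : ℤ) : ℚ)) / 4 := by
  obtain ⟨-, -, -, -, -, -, -, -, -, -, -, -, -, -, -, -, -, -, -, -, -, -, -, -, -, -, -, -, -,
    hV, hE⟩ := hΘ
  set L := a + b + 4 with hL
  let c := label a L Q₁ Q₂ R₁ R₂ S T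
  have hcS : ∀ k ≤ a, c (k + 1) = S.getVert k := by
    intro k hk
    simp [c, label, hk]
  have hcT : ∀ k ≤ b, c (L - 1 - k) = T.getVert k := by
    intro k hk
    dsimp only [c, label]
    rw [if_neg (by omega), if_neg (by omega), if_neg (by omega), if_pos (by omega)]
    congr 1
    omega
  have hc0 : c 0 = Q₁.getVert 1 := by simp [c, label]
  have hcr : c (a + 2) = R₁.getVert 1 := by simp [c, label]
  have hcL : c L = Q₂.getVert 1 := by
    dsimp only [c, label]
    rw [if_neg (by omega), if_neg (by omega), if_neg (by omega), if_neg (by omega), if_pos rfl]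
  have hcL1 : c (L + 1) = R₂.getVert 1 := by
    dsimp only [c, label]
    rw [if_neg (by omega), if_neg (by omega), if_neg (by omega), if_neg (by omega),
      if_neg (by omega)]
  have hcw : c 1 = w := by rw [← S.getVert_zero]; exact hcS 0 (by omega)
  have hcx : c (a + 1) = x := by rw [hcS a le_rfl, ← hS, S.getVert_length]
  have hcy : c (L - 1) = y := by rw [← T.getVert_zero]; exact hcT 0 (by omega)
  have hcz : c (a + 3) = z := by
    have := hcT b le_rfl
    rw [show L - 1 - b = a + 3 by omega] at this
    rw [this, ← hT, T.getVert_length]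
  have e0 : edg L (a + 2) 0 = (0, 1) := by simp [edg, hL]
  have eS : ∀ k < a, edg L (a + 2) (k + 1) = (k + 1, k + 1 + 1) := by
    intro k hk; unfold edg; rw [if_pos (by omega)]
  have ex : edg L (a + 2) (a + 1) = (a + 1, a + 2) := by unfold edg; rw [if_pos (by omega)]
  have er : edg L (a + 2) (a + 2) = (a + 2, a + 3) := by unfold edg; rw [if_pos (by omega)]
  have eT : ∀ k < b, edg L (a + 2) (L - 1 - (k + 1)) = (L - 1 - (k + 1), L - 1 - k) := by
    intro k hk
    unfold edg; rw [if_pos (by omega)]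
    congr 1
    omega
  have ey : edg L (a + 2) (L - 1) = (L - 1, 0) := by
    unfold edg; rw [if_neg (by omega), if_pos (by omega)]
  have eL : edg L (a + 2) L = (L, 1) := by simp [edg]
  have eL1 : edg L (a + 2) (L + 1) = (L - 1, L) := by
    unfold edg
    rw [if_neg (by omega), if_neg (by omega), if_neg (by omega), if_pos rfl]
  have eL2 : edg L (a + 2) (L + 2) = (L + 1, a + 3) := by
    unfold edg
    rw [if_neg (by omega), if_neg (by omega), if_neg (by omega), if_neg (by omega), if_pos rfl]
  have eL3 : edg L (a + 2) (L + 3) = (a + 1, L + 1) := by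
    unfold edg
    rw [if_neg (by omega), if_neg (by omega), if_neg (by omega), if_neg (by omega),
      if_neg (by omega)]
    rfl
  refine revSz_eq_of_label c (by omega) (by omega) (by omega) ?_ ?_ ?_
  · have two : ∀ {u v : V} (P : G.Walk u v), P.length = 2 → ∀ p ∈ P.support,
        p = u ∨ p = P.getVert 1 ∨ p = v := by
      intro u v P hP p hp
      obtain ⟨k, rfl, hk⟩ := SimpleGraph.Walk.mem_support_iff_exists_getVert.1 hp
      rw [hP] at hk
      interval_cases k
      · simp
      · simp
      · simp [← hP]
    have hw : ∃ i < L + 2, c i = w := ⟨_, by omega, hcw⟩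
    have hx : ∃ i < L + 2, c i = x := ⟨_, by omega, hcx⟩
    have hy : ∃ i < L + 2, c i = y := ⟨_, by omega, hcy⟩
    have hz : ∃ i < L + 2, c i = z := ⟨_, by omega, hcz⟩
    intro v
    rcases hV v with h | h | h | h | h | h
    · rcases two Q₁ hQ₁ v h with rfl | rfl | rfl
      exacts [hw, ⟨_, by omega, hc0⟩, hy]
    · rcases two Q₂ hQ₂ v h with rfl | rfl | rfl
      exacts [hw, ⟨_, by omega, hcL⟩, hy]
    · rcases two R₁ hR₁ v h with rfl | rfl | rfl
      exacts [hx, ⟨_, by omega, hcr⟩, hz]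
    · rcases two R₂ hR₂ v h with rfl | rfl | rfl
      exacts [hx, ⟨_, by omega, hcL1⟩, hz]
    · obtain ⟨k, rfl, hk⟩ := SimpleGraph.Walk.mem_support_iff_exists_getVert.1 h
      exact ⟨_, by omega, hcS k (by omega)⟩
    · obtain ⟨k, rfl, hk⟩ := SimpleGraph.Walk.mem_support_iff_exists_getVert.1 h
      exact ⟨_, by omega, hcT k (by omega)⟩
  · have two : ∀ {u v : V} (P : G.Walk u v), P.length = 2 →
        G.Adj u (P.getVert 1) ∧ G.Adj (P.getVert 1) v := by
      intro u v P hP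
      have h0 := P.adj_getVert_succ (i := 0) (by omega)
      have h1 := P.adj_getVert_succ (i := 1) (by omega)
      have h2 : P.getVert 2 = v := hP ▸ P.getVert_length
      simp only [zero_add, P.getVert_zero] at h0
      rw [h2] at h1
      exact ⟨h0, h1⟩
    intro t ht
    have ht' : t = 0 ∨ (∃ k < a, t = k + 1) ∨ t = a + 1 ∨ t = a + 2 ∨
        (∃ k < b, t = L - 1 - (k + 1)) ∨ t = L - 1 ∨ t = L ∨ t = L + 1 ∨ t = L + 2 ∨
        t = L + 3 := by
      by_cases h1 : 1 ≤ t ∧ t ≤ a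
      · exact .inr (.inl ⟨t - 1, by omega, by omega⟩)
      · by_cases h2 : a + 3 ≤ t ∧ t ≤ L - 2
        · exact .inr (.inr (.inr (.inr (.inl ⟨L - 2 - t, by omega, by omega⟩))))
        · omega
    rcases ht' with rfl | ⟨k, hk, rfl⟩ | rfl | rfl | ⟨k, hk, rfl⟩ | rfl | rfl | rfl | rfl | rfl
    · simpa only [e0, hc0, hcw] using (two Q₁ hQ₁).1.symm
    · simpa only [eS k hk, hcS k hk.le, hcS (k + 1) hk] using S.adj_getVert_succ (hS ▸ hk)
    · simpa only [ex, hcx, hcr] using (two R₁ hR₁).1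
    · simpa only [er, hcr, hcz] using (two R₁ hR₁).2
    · simpa only [eT k hk, hcT k hk.le, hcT (k + 1) hk] using
        (T.adj_getVert_succ (hT ▸ hk)).symm
    · simpa only [ey, hcy, hc0] using (two Q₁ hQ₁).2.symm
    · simpa only [eL, hcL, hcw] using (two Q₂ hQ₂).1.symm
    · simpa only [eL1, hcL, hcy] using (two Q₂ hQ₂).2.symm
    · simpa only [eL2, hcL1, hcz] using (two R₂ hR₂).2
    · simpa only [eL3, hcL1, hcx] using (two R₂ hR₂).1
  · have two : ∀ {u v : V} (P : G.Walk u v), P.length = 2 → ∀ e ∈ P.edges,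
        e = s(u, P.getVert 1) ∨ e = s(P.getVert 1, v) := by
      intro u v P hP e he
      induction e with | h p q
      obtain ⟨k, hk, h⟩ := P.mk_mem_edges_iff_exists.1 he
      rw [hP] at hk
      have h2 : P.getVert 2 = v := hP ▸ P.getVert_length
      interval_cases k
      · simp [← h]
      · simp [← h, h2]
    intro e he
    rcases hE e he with h | h | h | h | h | h
    · rcases two Q₁ hQ₁ e h with rfl | rfl
      · exact ⟨0, by omega, by simp only [e0, hc0, hcw, Sym2.eq_swap]⟩
      · exact ⟨L - 1, by omega, by simp only [ey, hc0, hcy, Sym2.eq_swap]⟩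
    · rcases two Q₂ hQ₂ e h with rfl | rfl
      · exact ⟨L, by omega, by simp only [eL, hcL, hcw, Sym2.eq_swap]⟩
      · exact ⟨L + 1, by omega, by simp only [eL1, hcL, hcy, Sym2.eq_swap]⟩
    · rcases two R₁ hR₁ e h with rfl | rfl
      · exact ⟨a + 1, by omega, by simp only [ex, hcr, hcx]⟩
      · exact ⟨a + 2, by omega, by simp only [er, hcr, hcz]⟩
    · rcases two R₂ hR₂ e h with rfl | rfl
      · exact ⟨L + 3, by omega, by simp only [eL3, hcL1, hcx]⟩
      · exact ⟨L + 2, by omega, by simp only [eL2, hcL1, hcz, Sym2.eq_swap]⟩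
    · induction e with | h p q
      obtain ⟨k, hk, h⟩ := S.mk_mem_edges_iff_exists.1 h
      rw [hS] at hk
      exact ⟨k + 1, by omega, by simp only [eS k hk, hcS k hk.le, hcS (k + 1) hk, h]⟩
    · induction e with | h p q
      obtain ⟨k, hk, h⟩ := T.mk_mem_edges_iff_exists.1 h
      rw [hT] at hk
      exact ⟨L - 1 - (k + 1), by omega, by
        simp only [eT k hk, hcT k hk.le, hcT (k + 1) hk, ← h, Sym2.eq_swap]⟩

end ThetaCycle

/-- For `n ≥ 29`, the graph `Fₙ` satisfies `Sz*(Fₙ) = (n³+2n²−16)/4` if `n` is even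
and `Sz*(Fₙ) = (n³+2n²−18)/4` if `n` is odd. -/
theorem revSz_FGraph {V : Type*} [Fintype V] (G : SimpleGraph V) (n : ℕ)
    (hn : 29 ≤ n) (hcard : Fintype.card V = n) (hF : IsFGraph n G) :
    revSz G = if Even n then ((n : ℚ) ^ 3 + 2 * (n : ℚ) ^ 2 - 16) / 4
      else ((n : ℚ) ^ 3 + 2 * (n : ℚ) ^ 2 - 18) / 4 := by
  obtain ⟨a, b, ha, hb, hab, hpar, w, y, x, z, Q₁, Q₂, R₁, R₂, S, T, hΘ, hQ₁, hQ₂, hR₁, hR₂,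
    hS, hT⟩ := hF
  rw [ThetaCycle.revSz_of_theta (by omega) hΘ hQ₁ hQ₂ hR₁ hR₂ hS hT ha hb]
  have hL : ((a + b + 4 : ℕ) : ℚ) = n - 2 := by
    rw [← hab]; push_cast; ring
  by_cases hn2 : Even n
  · rw [if_pos hn2] at hpar ⊢
    rw [hL, show a + b + 4 = 2 * (a + 2 + 1) by omega,
      ThetaCycle.sum_tdiff_sq_even (by omega)]
    push_cast
    ring
  · rw [if_neg hn2] at hpar ⊢
    rw [hL, show a + b + 4 = 2 * (a + 2) + 3 by omega,
      ThetaCycle.sum_tdiff_sq_odd (by omega)]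
    push_cast
    ring
end

section
/- Let G be a connected tricyclic graph of order n ≥ 12 that has at least one pendant edge (i.e., at least one vertex of degree 1). Then Sz*(G) < (n³ + 2n² − 18)/4. -/
attribute [local instance] Classical.propDecidable

/-- Every vertex is closer to `u`, closer to `v`, or equidistant from both. -/
lemma nC_add_nC_add_nE {V : Type*} [Fintype V] (G : SimpleGraph V) (u v : V) :
    nC G u v + nC G v u + nE G u v = Fintype.card V := by
  unfold nC nE
  simp only [Finset.card_filter, ← Finset.sum_add_distrib]
  rw [← Finset.card_univ, Finset.card_eq_sum_ones]
  refine Finset.sum_congr rfl fun w _ => ?_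
  rcases lt_trichotomy (G.dist u w) (G.dist v w) with h | h | h
  · simp [h, h.not_gt, h.ne]
  · simp [h]
  · simp [h, h.not_gt, h.ne']

lemma szContrib_mk {V : Type*} [Fintype V] (G : SimpleGraph V) (u v : V) :
    szContrib G s(u, v) =
      ((nC G u v : ℚ) + (nE G u v : ℚ) / 2) * ((nC G v u : ℚ) + (nE G u v : ℚ) / 2) := rfl

lemma szContrib_le {V : Type*} [Fintype V] (G : SimpleGraph V) (e : Sym2 V) :
    szContrib G e ≤ (Fintype.card V : ℚ) ^ 2 / 4 := by
  induction e with
  | _ u v =>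
    have h : (nC G u v : ℚ) + nC G v u + nE G u v = Fintype.card V := by
      exact_mod_cast nC_add_nC_add_nE G u v
    rw [szContrib_mk, ← h]
    nlinarith [sq_nonneg ((nC G u v : ℚ) - nC G v u)]

lemma dist_lt_dist_of_pendant {V : Type*} {G : SimpleGraph V} (hconn : G.Connected) {u v w : V}
    (huniq : ∀ x, G.Adj v x → x = u) (hw : w ≠ v) : G.dist u w < G.dist v w := by
  obtain ⟨p, hp⟩ := hconn.exists_walk_length_eq_dist v w
  cases p with
  | nil => exact absurd rfl hw
  | cons h q =>
    obtain rfl := huniq _ h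
    rw [← hp, SimpleGraph.Walk.length_cons]
    exact Nat.lt_succ_of_le (SimpleGraph.dist_le q)

lemma szContrib_pendant_le {V : Type*} [Fintype V] {G : SimpleGraph V} (hconn : G.Connected)
    {u v : V} (huniq : ∀ x, G.Adj v x → x = u) (hcard : 2 ≤ Fintype.card V) :
    szContrib G s(u, v) ≤ (Fintype.card V : ℚ) - 1 := by
  have hle : Fintype.card V - 1 ≤ nC G u v := by
    rw [← Finset.card_univ, ← Finset.card_erase_of_mem (Finset.mem_univ v)]
    refine Finset.card_le_card fun w hw => ?_
    simpa using dist_lt_dist_of_pendant hconn huniq (Finset.ne_of_mem_erase hw)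
  have hle' : (Fintype.card V : ℚ) ≤ nC G u v + 1 := by
    exact_mod_cast (by omega : Fintype.card V ≤ nC G u v + 1)
  have h : (nC G u v : ℚ) + nC G v u + nE G u v = Fintype.card V := by
    exact_mod_cast nC_add_nC_add_nE G u v
  have hcard' : (2 : ℚ) ≤ Fintype.card V := by exact_mod_cast hcard
  have hE : (0 : ℚ) ≤ nE G u v := Nat.cast_nonneg _
  rw [szContrib_mk, show (nC G v u : ℚ) + (nE G u v : ℚ) / 2 =
    Fintype.card V - ((nC G u v : ℚ) + (nE G u v : ℚ) / 2) by linarith]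
  generalize hA : (nC G u v : ℚ) + (nE G u v : ℚ) / 2 = a
  have h1 : (0 : ℚ) ≤ a - (Fintype.card V - 1) := by linarith
  have h2 : (0 : ℚ) ≤ a - 1 := by linarith
  nlinarith [mul_nonneg h1 h2]

/-- A connected tricyclic graph of order `n ≥ 12` with a pendant edge has revised
Szeged index less than `(n³ + 2n² − 18)/4`. -/
theorem revSz_lt_of_pendant {V : Type*} [Fintype V] (G : SimpleGraph V)
    (hconn : G.Connected) (htri : G.edgeFinset.card = Fintype.card V + 2)
    (hn : 12 ≤ Fintype.card V) (hpend : ∃ v : V, G.degree v = 1) :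
    revSz G < ((Fintype.card V : ℚ) ^ 3 + 2 * (Fintype.card V : ℚ) ^ 2 - 18) / 4 := by
  obtain ⟨v, hv⟩ := hpend
  obtain ⟨u, huv, huniq⟩ := SimpleGraph.degree_eq_one_iff_existsUnique_adj.mp hv
  have hmem : s(u, v) ∈ G.edgeFinset := by
    simpa using huv.symm
  have hpe := szContrib_pendant_le hconn huniq (by omega)
  have hrest : ∑ e ∈ G.edgeFinset.erase s(u, v), szContrib G e ≤
      ((Fintype.card V : ℚ) + 1) * ((Fintype.card V : ℚ) ^ 2 / 4) := by
    refine (Finset.sum_le_card_nsmul _ _ _ fun e _ => szContrib_le G e).trans_eq ?_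
    rw [Finset.card_erase_of_mem hmem, htri, nsmul_eq_mul]
    simp
  have hn' : (12 : ℚ) ≤ Fintype.card V := by exact_mod_cast hn
  unfold revSz
  rw [← Finset.add_sum_erase _ _ hmem]
  nlinarith [mul_self_nonneg ((Fintype.card V : ℚ) - 12)]
end

section
/- Let G be a connected tricyclic graph of order n ≥ 12 with minimum degree at least 2 (no pendant edges) that has a cut vertex. Then Sz*(G) < (n³ + 2n² − 18)/4. -/
attribute [local instance] Classical.propDecidable

namespace SimpleGraph

variable {V : Type*} {G : SimpleGraph V}

lemma Connected.le_add_mul_dist (hconn : G.Connected) {f : V → ℤ} {K : ℤ}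
    (hf : ∀ x y, G.Adj x y → f y ≤ f x + K) (x y : V) : f y ≤ f x + K * G.dist x y := by
  obtain ⟨p, hp⟩ := hconn.exists_walk_length_eq_dist x y
  rw [← hp]
  clear hp
  induction p with
  | nil => simp
  | cons h p ih =>
    have := hf _ _ h
    rw [Walk.length_cons]
    push_cast
    linarith

lemma Connected.exists_adj_boundary (hconn : G.Connected) {S : Set V} {x y : V}
    (hx : x ∈ S) (hy : y ∉ S) : ∃ a ∈ S, ∃ b ∉ S, G.Adj a b := by
  obtain ⟨p⟩ := hconn x y
  obtain ⟨d, -, h1, h2⟩ := p.exists_boundary_dart S hx hy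
  exact ⟨d.fst, h1, d.snd, h2, d.adj⟩

lemma Connected.dist_le_dist_add_one (hconn : G.Connected) {x y : V} (h : G.Adj x y) (w : V) :
    G.dist x w ≤ G.dist y w + 1 := by
  have := hconn.dist_triangle (u := x) (v := y) (w := w)
  rw [dist_eq_one_iff_adj.2 h] at this
  omega

/-- The sum of the distances from a vertex to all vertices. -/
noncomputable def transmission [Fintype V] (G : SimpleGraph V) (v : V) : ℤ :=
  ∑ w, (G.dist v w : ℤ)

/-- `A` is a union of components of `G - v`, but not all of `G - v`. -/
structure IsLobe (G : SimpleGraph V) (v : V) (A : Finset V) : Prop where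
  notMem : v ∉ A
  nonempty : A.Nonempty
  exists_notMem : ∃ y, y ≠ v ∧ y ∉ A
  closed : ∀ x ∈ A, ∀ y, G.Adj x y → y ∈ A ∨ y = v

namespace IsLobe

variable {v : V} {A : Finset V}

lemma dist_add_dist_le (hA : G.IsLobe v A) (hconn : G.Connected) {x w : V} (hx : x ∈ A)
    (hw : w ∉ A) : G.dist v x + G.dist v w ≤ G.dist x w := by
  have key := hconn.le_add_mul_dist (K := 1)
    (f := fun z => if z ∈ A then -(G.dist v z : ℤ) else G.dist v z) (by
      intro a b hab
      have h1 := hconn.dist_le_dist_add_one hab v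
      have h2 := hconn.dist_le_dist_add_one hab.symm v
      rw [G.dist_comm, G.dist_comm (v := v)] at h1 h2
      have h3 := hA.closed a
      have h4 : G.dist v v = 0 := dist_self
      by_cases ha : a ∈ A <;> by_cases hb : b ∈ A <;> simp only [ha, hb, if_true, if_false]
      · omega
      · obtain rfl : b = v := (h3 ha b hab).resolve_left hb
        omega
      · omega
      · omega) x w
  simp only [hx, hw, if_true, if_false] at key
  omega

lemma exists_adj (hA : G.IsLobe v A) (hconn : G.Connected) : ∃ x ∈ A, G.Adj v x := by
  obtain ⟨x, hx⟩ := hA.nonempty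
  obtain ⟨a, ha, b, hb, hab⟩ := hconn.exists_adj_boundary (S := (A : Set V)) hx hA.notMem
  obtain rfl := (hA.closed a ha b hab).resolve_left hb
  exact ⟨a, ha, hab.symm⟩

variable [Fintype V]

lemma compl (hA : G.IsLobe v A) : G.IsLobe v (insert v A)ᶜ where
  notMem := by simp
  nonempty := by
    obtain ⟨y, hy⟩ := hA.exists_notMem
    exact ⟨y, by simp [hy]⟩
  exists_notMem := by
    obtain ⟨y, hy⟩ := hA.nonempty
    exact ⟨y, fun h => hA.notMem (h ▸ hy), by simp [hy]⟩
  closed := by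
    intro x hx y hxy
    simp only [Finset.mem_compl, Finset.mem_insert, not_or] at hx ⊢
    by_cases hy : y = v
    · exact Or.inr hy
    · refine Or.inl ⟨hy, fun h => ?_⟩
      have := hA.closed y h x hxy.symm
      tauto

/-- If the transmission is `4`-Lipschitz, a lobe with at most `4` vertices has a small
complement. -/
lemma card_compl_le (hA : G.IsLobe v A) (hconn : G.Connected)
    (hlip : ∀ x y, G.Adj x y → G.transmission y ≤ G.transmission x + 4) (hcard : A.card ≤ 4) :
    (insert v A)ᶜ.card ≤ 6 := by
  have hsplit (f : V → ℤ) : ∑ w, f w = f v + ∑ w ∈ A, f w + ∑ w ∈ (insert v A)ᶜ, f w := by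
    rw [← Finset.sum_insert hA.notMem, Finset.sum_add_sum_compl]
  have hout {x : V} (hx : x ∈ A) {c : ℕ} (hc : G.dist v x = c) :
      (c : ℤ) * (insert v A)ᶜ.card ≤
        ∑ w ∈ (insert v A)ᶜ, ((G.dist x w : ℤ) - G.dist v w) := by
    rw [mul_comm, ← nsmul_eq_mul]
    refine Finset.card_nsmul_le_sum _ _ _ fun w hw => ?_
    have := hA.dist_add_dist_le hconn hx (w := w) (by simp at hw; tauto)
    omega
  by_cases h2 : ∃ x ∈ A, G.dist v x = 2
  · obtain ⟨x, hx, hx2⟩ := h2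
    have hL := hconn.le_add_mul_dist hlip v x
    obtain ⟨y, hvy, hyx⟩ : ∃ y, G.Adj v y ∧ G.Adj y x := by
      obtain ⟨p, hp⟩ := hconn.exists_walk_length_eq_dist v x
      rw [hx2] at hp
      refine ⟨p.getVert 1, ?_, ?_⟩
      · simpa using p.adj_getVert_succ (i := 0) (by omega)
      · have := p.adj_getVert_succ (i := 1) (by omega)
        rwa [show 1 + 1 = p.length by omega, p.getVert_length] at this
    have hy : y ∈ A := (hA.closed x hx y hyx.symm).resolve_right hvy.ne'
    have hsum := hsplit fun w => (G.dist x w : ℤ) - G.dist v w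
    rw [Finset.sum_sub_distrib, ← Finset.add_sum_erase _ _ hx,
      ← Finset.add_sum_erase (A.erase x) _ (Finset.mem_erase.2 ⟨hyx.ne, hy⟩)] at hsum
    have hrest : -2 * ((A.erase x).erase y).card ≤
        ∑ w ∈ (A.erase x).erase y, ((G.dist x w : ℤ) - G.dist v w) := by
      rw [mul_comm, ← nsmul_eq_mul]
      refine Finset.card_nsmul_le_sum _ _ _ fun w _ => ?_
      have := hconn.dist_triangle (u := v) (v := x) (w := w)
      omega
    rw [Finset.card_erase_of_mem (Finset.mem_erase.2 ⟨hyx.ne, hy⟩), Finset.card_erase_of_mem hx]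
      at hrest
    have hB := hout hx hx2
    have e1 : G.dist x v = 2 := by rw [dist_comm, hx2]
    have e2 : G.dist x y = 1 := dist_eq_one_iff_adj.2 hyx.symm
    have e3 : G.dist v y = 1 := dist_eq_one_iff_adj.2 hvy
    have e4 : G.dist v v = 0 := dist_self
    have e5 : G.dist x x = 0 := dist_self
    unfold transmission at hL
    simp only [e1, e2, e3, e4, e5, hx2] at hsum hL
    push_cast at hsum hL hB
    omega
  · have h1 : ∀ x ∈ A, G.dist v x = 1 := by
      intro x hx
      by_contra h
      have h0 : G.dist v x ≠ 0 := by
        rw [Ne, hconn.dist_eq_zero_iff]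
        rintro rfl
        exact hA.notMem hx
      have hlt : 2 ≤ G.dist v x := by omega
      obtain ⟨p, hp⟩ := hconn.exists_walk_length_eq_dist v x
      have hd : G.dist v (p.getVert 2) = 2 := by
        have a1 := G.dist_le (p.take 2)
        have a2 := G.dist_le (p.drop 2)
        have a3 := hconn.dist_triangle (u := v) (v := p.getVert 2) (w := x)
        rw [Walk.take_length] at a1
        rw [Walk.drop_length] at a2
        omega
      by_cases hm : p.getVert 2 ∈ A
      · exact h2 ⟨_, hm, hd⟩
      · have b1 := hA.dist_add_dist_le hconn hx hm
        have a2 := G.dist_le (p.drop 2)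
        rw [Walk.drop_length, dist_comm] at a2
        omega
    obtain ⟨x, hx⟩ := hA.nonempty
    have hL := hconn.le_add_mul_dist hlip v x
    have hsum := hsplit fun w => (G.dist x w : ℤ) - G.dist v w
    rw [Finset.sum_sub_distrib, ← Finset.add_sum_erase _ _ hx] at hsum
    have hrest : 0 ≤ ∑ w ∈ A.erase x, ((G.dist x w : ℤ) - G.dist v w) := by
      refine Finset.sum_nonneg fun w hw => ?_
      rw [Finset.mem_erase] at hw
      rw [h1 w hw.2]
      have := hconn.pos_dist_of_ne hw.1.symm
      omega
    have hB := hout hx (h1 x hx)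
    have e1 : G.dist x v = 1 := by rw [dist_comm, h1 x hx]
    have e4 : G.dist v v = 0 := dist_self
    have e5 : G.dist x x = 0 := dist_self
    unfold transmission at hL
    simp only [e1, e4, e5, h1 x hx] at hsum hL
    push_cast at hsum hL hB
    omega

end IsLobe

/-- The part of `G` spanned by `S`, as a graph on all vertices. -/
def within (G : SimpleGraph V) (S : Set V) : SimpleGraph V where
  Adj x y := G.Adj x y ∧ x ∈ S ∧ y ∈ S
  symm := ⟨fun _ _ h => ⟨h.1.symm, h.2.2, h.2.1⟩⟩
  loopless := ⟨fun _ h => G.loopless.irrefl _ h.1⟩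

lemma within_adj {S : Set V} {x y : V} : (G.within S).Adj x y ↔ G.Adj x y ∧ x ∈ S ∧ y ∈ S :=
  Iff.rfl

/-- If `q` parametrizes a cycle to which the rest of the graph is attached at `q 0` only, then
moving one step along the cycle does not decrease the sum of the distances to the cycle. -/
lemma Connected.sum_dist_le_of_cycle (hconn : G.Connected) {k : ℕ} [NeZero k] {q : ZMod k → V}
    (hinj : q.Injective) (hadj : ∀ i, G.Adj (q i) (q (i + 1)))
    (hedge : ∀ i, i ≠ 0 → ∀ y, G.Adj (q i) y → y = q (i + 1) ∨ y = q (i - 1)) :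
    ∑ i, G.dist (q 0) (q i) ≤ ∑ i, G.dist (q 1) (q i) := by
  have hup (i : ZMod k) : G.dist (q 0) (q i) ≤ i.valMinAbs.natAbs := by
    have h1 (n : ℕ) : G.dist (q 0) (q (n : ZMod k)) ≤ n := by
      induction n with
      | zero => simp
      | succ n ih =>
        have := hconn.dist_le_dist_add_one (hadj (n : ZMod k)).symm (q 0)
        rw [dist_comm, G.dist_comm (v := q 0)] at this
        push_cast
        omega
    have h2 (n : ℕ) : G.dist (q 0) (q (-(n : ZMod k))) ≤ n := by
      induction n with
      | zero => simp
      | succ n ih =>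
        have := hconn.dist_le_dist_add_one (hadj (-(n : ZMod k) - 1)) (q 0)
        rw [dist_comm, G.dist_comm (v := q 0), sub_add_cancel] at this
        rw [Nat.cast_succ, neg_add']
        omega
    rcases Int.natAbs_eq i.valMinAbs with h | h
    · have := h1 i.valMinAbs.natAbs
      rwa [← Int.cast_natCast (R := ZMod k), ← h, ZMod.coe_valMinAbs] at this
    · have := h2 i.valMinAbs.natAbs
      rwa [← Int.cast_natCast (R := ZMod k), ← Int.cast_neg, ← h, ZMod.coe_valMinAbs] at this
  have hlow (i : ZMod k) : (i - 1).valMinAbs.natAbs ≤ G.dist (q 1) (q i) := by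
    set j : V → ZMod k := Function.extend q id fun _ => 0 with hj
    have hjq (i) : j (q i) = i := by simp [hj, hinj.extend_apply]
    have hj0 (x) (hx : ¬ ∃ i, q i = x) : j x = 0 := Function.extend_apply' _ _ _ hx
    have hstep (x y : V) (hxy : G.Adj x y) : j y = j x ∨ j y = j x + 1 ∨ j y = j x - 1 := by
      by_cases hx : j x = 0
      · by_cases hy : j y = 0
        · exact Or.inl (hy.trans hx.symm)
        · obtain ⟨i, rfl⟩ : ∃ i, q i = y := by
            by_contra h
            exact hy (hj0 y h)
          rw [hjq] at hy
          rcases hedge i hy x hxy.symm with rfl | rfl <;> simp [hjq]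
      · obtain ⟨i, rfl⟩ : ∃ i, q i = x := by
          by_contra h
          exact hx (hj0 x h)
        rw [hjq] at hx
        rcases hedge i hx y hxy with rfl | rfl <;> simp [hjq]
    have h1 : (1 : ZMod k).valMinAbs.natAbs ≤ 1 := by
      rw [ZMod.valMinAbs_natAbs_eq_min]
      exact (min_le_left _ _).trans (by rw [ZMod.val_one_eq_one_mod]; exact Nat.mod_le _ _)
    have hadd (a b : ZMod k) :
        (a + b).valMinAbs.natAbs ≤ a.valMinAbs.natAbs + b.valMinAbs.natAbs :=
      (ZMod.natAbs_valMinAbs_add_le a b).trans (Int.natAbs_add_le _ _)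
    have key := hconn.le_add_mul_dist (K := 1) (f := fun z => ((j z - 1).valMinAbs.natAbs : ℤ)) (by
      intro x y hxy
      rcases hstep x y hxy with h | h | h
      · rw [h]
        omega
      · have := hadd (j x - 1) 1
        rw [h, add_sub_right_comm]
        omega
      · have := hadd (j x - 1) (-1)
        rw [ZMod.natAbs_valMinAbs_neg] at this
        rw [h, sub_eq_add_neg (j x - 1)]
        omega) (q 1) (q i)
    simp only [hjq, sub_self, ZMod.valMinAbs_zero] at key
    omega
  calc ∑ i, G.dist (q 0) (q i) ≤ ∑ i : ZMod k, i.valMinAbs.natAbs :=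
        Finset.sum_le_sum fun i _ => hup i
    _ = ∑ i : ZMod k, (i - 1).valMinAbs.natAbs :=
        ((Equiv.subRight (1 : ZMod k)).sum_comp fun i : ZMod k => i.valMinAbs.natAbs).symm
    _ ≤ _ := Finset.sum_le_sum fun i _ => hlow i

/-- A cyclic parametrization of a cycle given as a walk. -/
lemma Walk.IsCycle.exists_zmod {H : SimpleGraph V} {v : V} {p : H.Walk v v} (hp : p.IsCycle) :
    ∃ k : ℕ, 3 ≤ k ∧ ∃ q : ZMod k → V, q.Injective ∧ q 0 = v ∧
      (∀ i, H.Adj (q i) (q (i + 1))) ∧ ∀ x ∈ p.support, ∃ i, q i = x := by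
  have h3 := hp.three_le_length
  have : NeZero p.length := ⟨by omega⟩
  have hmod (n : ℕ) (hn : n ≤ p.length) : p.getVert (n : ZMod p.length).val = p.getVert n := by
    rw [ZMod.val_natCast]
    rcases hn.lt_or_eq with h | h
    · rw [Nat.mod_eq_of_lt h]
    · rw [h, Nat.mod_self, p.getVert_length, p.getVert_zero]
  refine ⟨p.length, h3, fun i => p.getVert i.val, fun i j hij => ?_, by simp, fun i => ?_,
    fun x hx => ?_⟩
  · refine ZMod.val_injective _ (hp.getVert_injOn' ?_ ?_ hij)
    · have := i.val_lt
      simp only [Set.mem_ofPred_eq]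
      omega
    · have := j.val_lt
      simp only [Set.mem_ofPred_eq]
      omega
  · have hi := i.val_lt
    have := hmod (i.val + 1) (by omega)
    rw [Nat.cast_succ, ZMod.natCast_zmod_val] at this
    beta_reduce
    rw [this]
    exact p.adj_getVert_succ hi
  · obtain ⟨n, rfl, hn⟩ := Walk.mem_support_iff_exists_getVert.1 hx
    exact ⟨n, hmod n hn⟩

namespace IsLobe

variable {v : V} {A : Finset V} [Fintype V]

lemma neighborFinset_within (hA : G.IsLobe v A) {x : V} (hx : x ∈ A) :
    (G.within (insert v A : Finset V)).neighborFinset x = G.neighborFinset x := by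
  ext y
  have := hA.closed x hx y
  simp only [mem_neighborFinset, within_adj, Finset.coe_insert, Set.mem_insert_iff, Finset.mem_coe]
  tauto

lemma neighborFinset_within_self (hA : G.IsLobe v A) :
    (G.within (insert v A : Finset V)).neighborFinset v = {x ∈ A | G.Adj v x} := by
  ext y
  have := hA.notMem
  simp only [mem_neighborFinset, within_adj, Finset.coe_insert, Set.mem_insert_iff, Finset.mem_coe,
    Finset.mem_filter]
  constructor
  · rintro ⟨h1, -, rfl | h2⟩
    · exact (G.loopless.irrefl _ h1).elim
    · exact ⟨h2, h1⟩
  · tauto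

lemma even_sum_degree_add (hA : G.IsLobe v A) :
    Even (∑ x ∈ A, G.degree x + ({x ∈ A | G.Adj v x} : Finset V).card) := by
  have h := (G.within (insert v A : Finset V)).sum_degrees_eq_twice_card_edges
  rw [← Finset.sum_subset (Finset.subset_univ (insert v A)), Finset.sum_insert hA.notMem,
    ← card_neighborFinset_eq_degree, hA.neighborFinset_within_self,
    Finset.sum_congr rfl (g := fun x => G.degree x) fun x hx => by
      rw [← card_neighborFinset_eq_degree, hA.neighborFinset_within hx,
        card_neighborFinset_eq_degree]] at h
  · rw [add_comm, h]
    exact even_two_mul _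
  · intro x _ hx
    rw [← card_neighborFinset_eq_degree, Finset.card_eq_zero, Finset.eq_empty_iff_forall_notMem]
    intro y hy
    rw [mem_neighborFinset] at hy
    exact hx hy.2.1

/-- A lobe in which every vertex has degree `2`, attached by two edges, is a cycle. -/
lemma exists_zmod_cycle (hA : G.IsLobe v A) (hconn : G.Connected) (hdeg : ∀ x ∈ A, G.degree x = 2)
    (hv : ({x ∈ A | G.Adj v x} : Finset V).card = 2) :
    ∃ k : ℕ, 3 ≤ k ∧ ∃ q : ZMod k → V, q.Injective ∧ q 0 = v ∧
      (∀ i, G.Adj (q i) (q (i + 1))) ∧ ∀ x, x ∈ insert v A ↔ ∃ i, q i = x := by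
  set H := G.within (insert v A : Finset V)
  have hcard : ∀ x ∈ insert v A, (H.neighborFinset x).card = 2 := by
    intro x hx
    rcases Finset.mem_insert.1 hx with rfl | hx
    · rw [hA.neighborFinset_within_self, hv]
    · rw [hA.neighborFinset_within hx, card_neighborFinset_eq_degree, hdeg x hx]
  have hcyc : H.IsCycles := by
    rintro x ⟨y, hy⟩
    have := hcard x hy.2.1
    rwa [← Set.ncard_coe_finset, coe_neighborFinset] at this
  have hne : (H.neighborSet v).Nonempty := by
    rw [← coe_neighborFinset, Finset.coe_nonempty, ← Finset.card_pos, hcard v (by simp)]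
    omega
  obtain ⟨p, hp, hsupp⟩ := hcyc.exists_cycle_toSubgraph_verts_eq_connectedComponentSupp
    (c := H.connectedComponentMk v) rfl hne
  obtain ⟨k, hk, q, hinj, h0, hadj, hsurj⟩ := hp.exists_zmod
  refine ⟨k, hk, q, hinj, h0, fun i => (hadj i).1, fun x => ⟨fun hx => ?_, ?_⟩⟩
  · refine hsurj x ?_
    rw [← Walk.mem_verts_toSubgraph, hsupp]
    by_contra hxc
    obtain ⟨a, ⟨ha, hac⟩, b, hb, hab⟩ := hconn.exists_adj_boundary
      (S := {z | z ∈ insert v A ∧ z ∉ (H.connectedComponentMk v).supp}) ⟨hx, hxc⟩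
      (y := v) (fun h => h.2 rfl)
    have haA : a ∈ A := (Finset.mem_insert.1 ha).resolve_left (by rintro rfl; exact hac rfl)
    have hbS : b ∈ insert v A := by
      rw [Finset.mem_insert]
      exact (hA.closed a haA b hab).symm
    have hHab : H.Adj a b := ⟨hab, ha, hbS⟩
    refine hb ⟨hbS, fun hbc => hac ?_⟩
    rw [ConnectedComponent.mem_supp_iff] at hbc ⊢
    rw [← hbc]
    exact ConnectedComponent.sound hHab.reachable
  · rintro ⟨i, rfl⟩
    exact (hadj i).2.1

/-- A lobe which is a cycle has a complement with at most `4` vertices if the transmission is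
`4`-Lipschitz. -/
lemma card_compl_le_of_degree_eq_two (hA : G.IsLobe v A) (hconn : G.Connected)
    (hlip : ∀ x y, G.Adj x y → G.transmission y ≤ G.transmission x + 4)
    (hdeg : ∀ x ∈ A, G.degree x = 2) (hv : ({x ∈ A | G.Adj v x} : Finset V).card = 2) :
    (insert v A)ᶜ.card ≤ 4 := by
  obtain ⟨k, hk, q, hinj, rfl, hadj, himg⟩ := hA.exists_zmod_cycle hconn hdeg hv
  have : NeZero k := ⟨by omega⟩
  have : Fact (2 < k) := ⟨hk⟩
  have h01 : G.Adj (q 0) (q 1) := by simpa using hadj 0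
  have hmem (i : ZMod k) (hi : i ≠ 0) : q i ∈ A :=
    (Finset.mem_insert.1 ((himg _).2 ⟨i, rfl⟩)).resolve_left fun h => hi (hinj h)
  have hle := hconn.sum_dist_le_of_cycle hinj hadj fun i hi y hy => by
    have hsub : {q (i + 1), q (i - 1)} = G.neighborFinset (q i) := by
      refine Finset.eq_of_subset_of_card_le ?_ ?_
      · intro z hz
        rw [Finset.mem_insert, Finset.mem_singleton] at hz
        rw [mem_neighborFinset]
        rcases hz with rfl | rfl
        · exact hadj i
        · simpa using (hadj (i - 1)).symm
      · rw [card_neighborFinset_eq_degree, hdeg _ (hmem i hi), Finset.card_pair]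
        intro h
        have h2 := hinj h
        rw [sub_eq_add_neg] at h2
        exact ZMod.neg_one_ne_one (add_left_cancel h2).symm
    simpa [← hsub] using (mem_neighborFinset _ _ _).2 hy
  have himg' : insert (q 0) A = Finset.univ.image q := by
    ext x
    rw [himg]
    simp
  have hsum (f : V → ℤ) : ∑ w, f w = ∑ i, f (q i) + ∑ w ∈ (insert (q 0) A)ᶜ, f w := by
    rw [← Finset.sum_add_sum_compl (insert (q 0) A)]
    nth_rw 1 [himg']
    rw [Finset.sum_image fun i _ j _ h => hinj h]
  have hout : ((insert (q 0) A)ᶜ.card : ℤ) ≤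
      ∑ w ∈ (insert (q 0) A)ᶜ, ((G.dist (q 1) w : ℤ) - G.dist (q 0) w) := by
    rw [← nsmul_one]
    refine Finset.card_nsmul_le_sum _ _ _ fun w hw => ?_
    have := hA.dist_add_dist_le hconn (hmem 1 (by
      have : Fact (1 < k) := ⟨by omega⟩
      exact one_ne_zero)) (w := w) (by simp at hw; tauto)
    rw [dist_eq_one_iff_adj.2 h01] at this
    omega
  have h1 := hsum fun w => (G.dist (q 1) w : ℤ) - G.dist (q 0) w
  rw [Finset.sum_sub_distrib, Finset.sum_sub_distrib] at h1
  have h2 := hlip _ _ h01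
  unfold transmission at h2
  zify at hle
  linarith

/-- A lobe of cyclomatic number `1` contains a lobe which is a cycle. -/
lemma exists_isLobe_cycle (hA : G.IsLobe v A) (hconn : G.Connected) (hmin : ∀ x, 2 ≤ G.degree x)
    (hsum : ∑ x ∈ A, G.degree x + ({x ∈ A | G.Adj v x} : Finset V).card = 2 * A.card + 2) :
    ∃ (u : V) (C : Finset V), G.IsLobe u C ∧ (∀ x ∈ C, G.degree x = 2) ∧
      ({x ∈ C | G.Adj u x} : Finset V).card = 2 := by
  induction hn : A.card generalizing v A with
  | zero =>
    rw [Finset.card_eq_zero] at hn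
    exact absurd hA.nonempty (by simp [hn])
  | succ n ih =>
    have hge : ∑ x ∈ A, 2 ≤ ∑ x ∈ A, G.degree x := Finset.sum_le_sum fun x _ => hmin x
    have hge' := hge
    rw [Finset.sum_const, smul_eq_mul] at hge'
    obtain ⟨u, hu, hvu⟩ := hA.exists_adj hconn
    have hpos : 0 < ({x ∈ A | G.Adj v x} : Finset V).card :=
      Finset.card_pos.2 ⟨u, Finset.mem_filter.2 ⟨hu, hvu⟩⟩
    by_cases ht : ({x ∈ A | G.Adj v x} : Finset V).card = 2
    · refine ⟨v, A, hA, fun x hx => ?_, ht⟩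
      refine ((Finset.sum_eq_sum_iff_of_le fun x _ => hmin x).1 ?_ x hx).symm
      rw [Finset.sum_const, smul_eq_mul]
      omega
    · have ht1 : ({x ∈ A | G.Adj v x} : Finset V).card ≤ 1 := by omega
      have huniq : ∀ x ∈ A, G.Adj v x → x = u := fun x hx hvx =>
        Finset.card_le_one.1 ht1 x (Finset.mem_filter.2 ⟨hx, hvx⟩) u
          (Finset.mem_filter.2 ⟨hu, hvu⟩)
      have hnb : G.neighborFinset u = insert v ({x ∈ A.erase u | G.Adj u x} : Finset V) := by
        ext y
        have h1 := hA.closed u hu y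
        have h2 : G.Adj u y → y ≠ u := fun h => h.ne'
        simp only [mem_neighborFinset, Finset.mem_insert, Finset.mem_filter, Finset.mem_erase]
        constructor
        · tauto
        · rintro (rfl | h)
          · exact hvu.symm
          · exact h.2
      have hdeg : G.degree u = ({x ∈ A.erase u | G.Adj u x} : Finset V).card + 1 := by
        rw [← card_neighborFinset_eq_degree, hnb, Finset.card_insert_of_notMem]
        simp [hA.notMem]
      have hlobe : G.IsLobe u (A.erase u) := by
        refine ⟨by simp, ?_, ⟨v, hvu.ne, by simp [hA.notMem]⟩, fun x hx y hxy => ?_⟩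
        · have h2 := hmin u
          obtain ⟨y, hy⟩ := Finset.card_pos.1
            (show 0 < ({x ∈ A.erase u | G.Adj u x} : Finset V).card by omega)
          exact ⟨y, (Finset.mem_filter.1 hy).1⟩
        · rw [Finset.mem_erase] at hx ⊢
          rcases hA.closed x hx.2 y hxy with h | rfl
          · tauto
          · exact (hx.1 (huniq x hx.2 hxy.symm)).elim
      refine ih hlobe ?_ (by rw [Finset.card_erase_of_mem hu]; omega)
      rw [← Finset.add_sum_erase _ _ hu] at hsum
      rw [Finset.card_erase_of_mem hu]
      omega

/-- In a tricyclic graph without pendant vertices, one of the two sides of a cut vertex has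
cyclomatic number `1`. -/
lemma exists_cyclomatic_one (hA : G.IsLobe v A) (hconn : G.Connected)
    (hmin : ∀ x, 2 ≤ G.degree x) (htri : G.edgeFinset.card = Fintype.card V + 2) :
    ∃ B, G.IsLobe v B ∧
      ∑ x ∈ B, G.degree x + ({x ∈ B | G.Adj v x} : Finset V).card = 2 * B.card + 2 := by
  have hge (B : Finset V) (hB : G.IsLobe v B) :
      2 * B.card + 1 ≤ ∑ x ∈ B, G.degree x + ({x ∈ B | G.Adj v x} : Finset V).card := by
    have h1 : ∑ x ∈ B, 2 ≤ ∑ x ∈ B, G.degree x := Finset.sum_le_sum fun x _ => hmin x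
    rw [Finset.sum_const, smul_eq_mul] at h1
    obtain ⟨u, hu, hvu⟩ := hB.exists_adj hconn
    have hpos : 0 < ({x ∈ B | G.Adj v x} : Finset V).card :=
      Finset.card_pos.2 ⟨u, Finset.mem_filter.2 ⟨hu, hvu⟩⟩
    omega
  have hgA := hge A hA
  have hgB := hge _ hA.compl
  have heA := hA.even_sum_degree_add
  have heB := hA.compl.even_sum_degree_add
  have hsum := G.sum_degrees_eq_twice_card_edges
  rw [htri, ← Finset.sum_add_sum_compl (insert v A), Finset.sum_insert hA.notMem] at hsum
  have hcard := Finset.card_add_card_compl (insert v A)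
  rw [Finset.card_insert_of_notMem hA.notMem] at hcard
  have hdeg : G.degree v = ({x ∈ A | G.Adj v x} : Finset V).card +
      ({x ∈ (insert v A)ᶜ | G.Adj v x} : Finset V).card := by
    rw [← card_neighborFinset_eq_degree, ← Finset.card_union_of_disjoint]
    · congr 1
      ext y
      have : G.Adj v y → y ≠ v := fun h => h.ne'
      simp only [mem_neighborFinset, Finset.mem_union, Finset.mem_filter, Finset.mem_compl,
        Finset.mem_insert]
      tauto
    · refine Finset.disjoint_filter_filter ?_
      rw [Finset.disjoint_right]
      intro x hx
      simp only [Finset.mem_compl, Finset.mem_insert] at hx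
      tauto
  obtain ⟨a, ha⟩ := heA
  obtain ⟨b, hb⟩ := heB
  by_cases h : ∑ x ∈ A, G.degree x + ({x ∈ A | G.Adj v x} : Finset V).card = 2 * A.card + 2
  · exact ⟨A, hA, h⟩
  · exact ⟨_, hA.compl, by omega⟩

end IsLobe

lemma exists_isLobe [Fintype V] {v : V} (hn : 2 ≤ Fintype.card V)
    (hv : ¬ (G.induce ({v}ᶜ : Set V)).Connected) : ∃ A : Finset V, G.IsLobe v A := by
  have : Nontrivial V := Fintype.one_lt_card_iff_nontrivial.1 hn
  obtain ⟨z, hz⟩ := exists_ne v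
  have : Nonempty ({v}ᶜ : Set V) := ⟨⟨z, hz⟩⟩
  have hpre : ¬ (G.induce ({v}ᶜ : Set V)).Preconnected := fun h => hv ⟨h⟩
  unfold Preconnected at hpre
  push Not at hpre
  obtain ⟨x, y, hxy⟩ := hpre
  refine ⟨({z | ∃ h : z ∈ ({v}ᶜ : Set V), (G.induce ({v}ᶜ : Set V)).Reachable x ⟨z, h⟩} : Finset V),
    ⟨?_, ?_, ?_, ?_⟩⟩
  · simp
  · exact ⟨x, Finset.mem_filter.2 ⟨Finset.mem_univ _, x.2, Reachable.refl _⟩⟩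
  · exact ⟨y, y.2, fun h => hxy (Finset.mem_filter.1 h).2.2⟩
  · intro a ha b hab
    by_cases hb : b = v
    · exact Or.inr hb
    · obtain ⟨ha', hr⟩ := (Finset.mem_filter.1 ha).2
      refine Or.inl (Finset.mem_filter.2 ⟨Finset.mem_univ _, hb, hr.trans ?_⟩)
      exact Adj.reachable (G := G.induce ({v}ᶜ : Set V)) (u := ⟨a, ha'⟩) (v := ⟨b, hb⟩) hab

/-- The transmission of a tricyclic graph with a cut vertex and no pendant vertices changes by
at least `5` along some edge. -/
lemma exists_adj_transmission_add_five_le [Fintype V] (hconn : G.Connected)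
    (htri : G.edgeFinset.card = Fintype.card V + 2) (hn : 12 ≤ Fintype.card V)
    (hmin : ∀ v, 2 ≤ G.degree v) (hcut : ∃ v, ¬ (G.induce ({v}ᶜ : Set V)).Connected) :
    ∃ x y, G.Adj x y ∧ G.transmission x + 5 ≤ G.transmission y := by
  by_contra! h
  have hlip : ∀ x y, G.Adj x y → G.transmission y ≤ G.transmission x + 4 := fun x y hxy => by
    have := h x y hxy
    omega
  obtain ⟨v, hv⟩ := hcut
  obtain ⟨A, hA⟩ := exists_isLobe (by omega) hv
  obtain ⟨B, hB, hsum⟩ := hA.exists_cyclomatic_one hconn hmin htri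
  obtain ⟨u, C, hC, hdeg, hu⟩ := hB.exists_isLobe_cycle hconn hmin hsum
  have h4 := hC.card_compl_le_of_degree_eq_two hconn hlip hdeg hu
  have h6 := hC.compl.card_compl_le hconn hlip h4
  have hc1 := Finset.card_add_card_compl (insert u C)
  have hc2 := Finset.card_add_card_compl (insert u (insert u C)ᶜ)
  rw [Finset.card_insert_of_notMem hC.compl.notMem] at hc2
  omega

lemma nC_sub_nC [Fintype V] (hconn : G.Connected) {u v : V} (h : G.Adj u v) :
    (nC G u v : ℤ) - nC G v u = G.transmission v - G.transmission u := by
  unfold nC transmission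
  rw [Finset.card_filter, Finset.card_filter]
  push_cast
  rw [← Finset.sum_sub_distrib, ← Finset.sum_sub_distrib]
  refine Finset.sum_congr rfl fun w _ => ?_
  have h1 := hconn.dist_le_dist_add_one h w
  have h2 := hconn.dist_le_dist_add_one h.symm w
  split_ifs <;> omega

lemma nC_add_nC_add_nE [Fintype V] (u v : V) :
    nC G u v + nC G v u + nE G u v = Fintype.card V := by
  unfold nC nE
  rw [Finset.card_filter, Finset.card_filter, Finset.card_filter, ← Finset.sum_add_distrib,
    ← Finset.sum_add_distrib, ← Finset.card_univ, Finset.card_eq_sum_ones]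
  refine Finset.sum_congr rfl fun w _ => ?_
  split_ifs <;> omega

lemma szContrib_mk [Fintype V] (hconn : G.Connected) {u v : V} (h : G.Adj u v) :
    szContrib G s(u, v) =
      ((Fintype.card V : ℚ) ^ 2 - ((G.transmission v - G.transmission u : ℤ) : ℚ) ^ 2) / 4 := by
  rw [← nC_sub_nC hconn h, ← G.nC_add_nC_add_nE u v]
  simp only [szContrib, Sym2.lift_mk]
  push_cast
  ring

lemma szContrib_le [Fintype V] (hconn : G.Connected) {e : Sym2 V} (he : e ∈ G.edgeFinset) :
    szContrib G e ≤ (Fintype.card V : ℚ) ^ 2 / 4 := by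
  induction e with
  | h u v =>
    rw [mem_edgeFinset, mem_edgeSet] at he
    rw [szContrib_mk hconn he]
    linarith [sq_nonneg ((G.transmission v - G.transmission u : ℤ) : ℚ)]

end SimpleGraph

/-- A connected tricyclic graph of order `n ≥ 12` with minimum degree at least 2
and a cut vertex has revised Szeged index less than `(n³ + 2n² − 18)/4`. -/
theorem revSz_lt_of_cutVertex {V : Type*} [Fintype V] (G : SimpleGraph V)
    (hconn : G.Connected) (htri : G.edgeFinset.card = Fintype.card V + 2)
    (hn : 12 ≤ Fintype.card V) (hmin : ∀ v : V, 2 ≤ G.degree v)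
    (hcut : ∃ v : V, ¬ (G.induce ({v}ᶜ : Set V)).Connected) :
    revSz G < ((Fintype.card V : ℚ) ^ 3 + 2 * (Fintype.card V : ℚ) ^ 2 - 18) / 4 := by
  obtain ⟨x, y, hxy, h5⟩ :=
    SimpleGraph.exists_adj_transmission_add_five_le hconn htri hn hmin hcut
  have hmem : s(x, y) ∈ G.edgeFinset := by simpa using hxy
  have hone := SimpleGraph.szContrib_mk hconn hxy
  have hsq : (25 : ℚ) ≤ ((G.transmission y - G.transmission x : ℤ) : ℚ) ^ 2 := by
    have : (25 : ℤ) ≤ (G.transmission y - G.transmission x) ^ 2 := by nlinarith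
    exact_mod_cast this
  have hrest : ∑ e ∈ G.edgeFinset.erase s(x, y), szContrib G e ≤
      ((Fintype.card V : ℚ) + 1) * ((Fintype.card V : ℚ) ^ 2 / 4) := by
    have h := Finset.sum_le_card_nsmul (G.edgeFinset.erase s(x, y)) (szContrib G)
      ((Fintype.card V : ℚ) ^ 2 / 4) fun e he =>
        SimpleGraph.szContrib_le hconn (Finset.mem_of_mem_erase he)
    rw [Finset.card_erase_of_mem hmem, htri, nsmul_eq_mul] at h
    simpa using h
  rw [revSz, ← Finset.add_sum_erase _ _ hmem, hone]
  linarith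
end

section
/- Let G be a Θ1-graph composed of four internally disjoint paths P_1, P_2, P_3, P_4 joining two vertices x and y, and let e = uv be an edge of G. Then |n_u(e) − n_v(e)| ≤ 1 if and only if e is the middle edge of one of the paths P_1, P_2, P_3, P_4 of odd length (i.e., e lies on a path P_i of odd length and the two endpoints of e are at distances (len(P_i)−1)/2 from the two ends x and y along P_i). -/
attribute [local instance] Classical.propDecidable

/-- `G` consists of the two distinct vertices `x, y` joined by the four pairwise
internally disjoint paths `P₁, P₂, P₃, P₄`, every vertex and every edge of `G`
lying on one of these paths. -/
def Theta1Cond {V : Type*} (G : SimpleGraph V) (x y : V)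
    (P₁ P₂ P₃ P₄ : G.Walk x y) : Prop :=
  x ≠ y ∧
  P₁.IsPath ∧ P₂.IsPath ∧ P₃.IsPath ∧ P₄.IsPath ∧
  1 ≤ P₁.length ∧ 1 ≤ P₂.length ∧ 1 ≤ P₃.length ∧ 1 ≤ P₄.length ∧
  P₁ ≠ P₂ ∧ P₁ ≠ P₃ ∧ P₁ ≠ P₄ ∧ P₂ ≠ P₃ ∧ P₂ ≠ P₄ ∧ P₃ ≠ P₄ ∧
  IntDisj P₁ P₂ ∧ IntDisj P₁ P₃ ∧ IntDisj P₁ P₄ ∧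
  IntDisj P₂ P₃ ∧ IntDisj P₂ P₄ ∧ IntDisj P₃ P₄ ∧
  (∀ v : V, v ∈ P₁.support ∨ v ∈ P₂.support ∨ v ∈ P₃.support ∨ v ∈ P₄.support) ∧
  (∀ e ∈ G.edgeSet, e ∈ P₁.edges ∨ e ∈ P₂.edges ∨ e ∈ P₃.edges ∨ e ∈ P₄.edges)

/-- `G` is a Θ₁-graph. -/
def IsTheta1 {V : Type*} (G : SimpleGraph V) : Prop :=
  ∃ (x y : V) (P₁ P₂ P₃ P₄ : G.Walk x y), Theta1Cond G x y P₁ P₂ P₃ P₄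

/-- Vertex labelling of a graph made of four internally disjoint paths from `x` to `y`: the vertex
at position `t` on the `j`-th path, of length `l j`, is `s j t`. -/
structure IsThetaLabelling {V : Type*} (G : SimpleGraph V) (x y : V)
    (s : Fin 4 → ℕ → V) (l : Fin 4 → ℕ) : Prop where
  start : ∀ j, s j 0 = x
  finish : ∀ j, s j (l j) = y
  pos : ∀ j, 1 ≤ l j
  two_le : ∀ j j', j ≠ j' → 2 ≤ l j ∨ 2 ≤ l j'
  inj : ∀ j j' t t', t ≤ l j → t' ≤ l j' → s j t = s j' t' →
    (j = j' ∧ t = t') ∨ (t = 0 ∧ t' = 0) ∨ (t = l j ∧ t' = l j')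
  cover : ∀ v, ∃ j, ∃ t ≤ l j, s j t = v
  adj : ∀ j, ∀ t < l j, G.Adj (s j t) (s j (t + 1))
  edge : ∀ a b, G.Adj a b → ∃ j, ∃ t < l j,
    (a = s j t ∧ b = s j (t + 1)) ∨ (b = s j t ∧ a = s j (t + 1))

namespace IsThetaLabelling

variable {V : Type*} {G : SimpleGraph V} {x y : V} {s : Fin 4 → ℕ → V} {l : Fin 4 → ℕ}

/-- Reading all four paths backwards. -/
lemma reverse (h : IsThetaLabelling G x y s l) :
    IsThetaLabelling G y x (fun j t => s j (l j - t)) l where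
  start j := by simpa using h.finish j
  finish j := by simpa using h.start j
  pos := h.pos
  two_le := h.two_le
  inj j j' t t' ht ht' e := by
    have := h.inj j j' _ _ (Nat.sub_le _ _) (Nat.sub_le _ _) e
    rcases this with ⟨rfl, h1⟩ | h1 | h1
    · left; exact ⟨rfl, by omega⟩
    · right; right; omega
    · right; left; omega
  cover v := by
    obtain ⟨j, t, ht, rfl⟩ := h.cover v
    exact ⟨j, l j - t, Nat.sub_le _ _, by simp [Nat.sub_sub_self ht]⟩
  adj j t ht := by
    have := h.adj j (l j - (t + 1)) (by omega)
    rw [show l j - (t + 1) + 1 = l j - t by omega] at this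
    exact this.symm
  edge a b hab := by
    obtain ⟨j, t, ht, h1⟩ := h.edge a b hab
    refine ⟨j, l j - (t + 1), by omega, ?_⟩
    rw [show l j - (l j - (t + 1)) = t + 1 by omega,
      show l j - (l j - (t + 1) + 1) = t by omega]
    tauto

/-- Values along the paths that agree at both ends define a function on the vertices. -/
lemma exists_label {α : Type*} (h : IsThetaLabelling G x y s l) (F : Fin 4 → ℕ → α) (X Y : α)
    (hX : ∀ j, F j 0 = X) (hY : ∀ j, F j (l j) = Y) :
    ∃ f : V → α, ∀ j, ∀ t ≤ l j, f (s j t) = F j t := by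
  choose J T hT hs using h.cover
  refine ⟨fun v => F (J v) (T v), fun j t ht => ?_⟩
  rcases h.inj _ _ _ _ (hT (s j t)) ht (hs (s j t)) with ⟨h1, h2⟩ | ⟨h1, h2⟩ | ⟨h1, h2⟩
  · simp only [h1, h2]
  · exact (congrArg _ h1).trans <| (hX _).trans <| h2 ▸ (hX j).symm
  · exact (congrArg _ h1).trans <| (hY _).trans <| h2 ▸ (hY j).symm

lemma exists_walk (h : IsThetaLabelling G x y s l) (j : Fin 4) (t n : ℕ) (hn : t + n ≤ l j) :
    ∃ w : G.Walk (s j t) (s j (t + n)), w.length = n := by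
  induction n with
  | zero => exact ⟨.nil, rfl⟩
  | succ n ih =>
    obtain ⟨w, hw⟩ := ih (by omega)
    exact ⟨w.concat (h.adj j (t + n) (by omega)), by simp [hw]⟩

lemma connected (h : IsThetaLabelling G x y s l) : G.Connected := by
  have hx : ∀ v, G.Reachable x v := fun v => by
    obtain ⟨j, t, ht, rfl⟩ := h.cover v
    obtain ⟨w, -⟩ := h.exists_walk j 0 t (by omega)
    rw [h.start, zero_add] at w
    exact ⟨w⟩
  have : Nonempty V := ⟨x⟩
  exact ⟨fun u v => (hx u).symm.trans (hx v)⟩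

lemma dist_le_sub (h : IsThetaLabelling G x y s l) (j : Fin 4) {t t' : ℕ} (htt : t ≤ t')
    (ht : t' ≤ l j) : G.dist (s j t) (s j t') ≤ t' - t := by
  obtain ⟨n, rfl⟩ := Nat.exists_eq_add_of_le htt
  obtain ⟨w, hw⟩ := h.exists_walk j t n ht
  simpa [hw] using SimpleGraph.dist_le w

lemma dist_start_le (h : IsThetaLabelling G x y s l) (j : Fin 4) {t : ℕ} (ht : t ≤ l j) :
    G.dist x (s j t) ≤ t := by
  simpa [h.start] using h.dist_le_sub j (Nat.zero_le t) ht

lemma dist_finish_le (h : IsThetaLabelling G x y s l) (j : Fin 4) {t : ℕ} (ht : t ≤ l j) :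
    G.dist y (s j t) ≤ l j - t := by
  simpa [h.finish, SimpleGraph.dist_comm] using h.dist_le_sub j ht le_rfl

lemma dist_start_finish_le (h : IsThetaLabelling G x y s l) (j : Fin 4) : G.dist x y ≤ l j := by
  simpa [h.finish] using h.dist_start_le j (le_refl (l j))

end IsThetaLabelling

/-- A function that vanishes at `u` and is `1`-Lipschitz along edges bounds the distance to `u`
from below. -/
lemma SimpleGraph.Connected.le_dist_of_lipschitz {V : Type*} {G : SimpleGraph V}
    (hG : G.Connected) (f : V → ℕ) (hf : ∀ a b, G.Adj a b → f b ≤ f a + 1) {u : V}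
    (hu : f u = 0) (w : V) : f w ≤ G.dist u w := by
  have key : ∀ {a b : V} (p : G.Walk a b), f b ≤ f a + p.length := by
    intro a b p
    induction p with
    | nil => simp
    | cons hab p ih =>
      have := hf _ _ hab
      simp only [SimpleGraph.Walk.length_cons]
      omega
  obtain ⟨p, hp⟩ := hG.exists_walk_length_eq_dist u w
  have := key p
  omega

/-- Distance from the vertex at position `p` on a path of length `a` to the vertex at position `t`
on the same path, when the shortest other path has length `b`. -/
def thetaDistSame (a b p t : ℕ) : ℕ :=
  min ((t - p) + (p - t)) (min (min p (a - p + b) + t) (min (a - p) (p + b) + (a - t)))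

/-- Distance from the vertex at position `p` on a path of length `a` to the vertex at position `t`
on another path of length `c`, when the shortest other path has length `b`. -/
def thetaDistOther (a b c p t : ℕ) : ℕ :=
  min (min p (a - p + b) + t) (min (a - p) (p + b) + (c - t))

namespace IsThetaLabelling

variable {V : Type*} {G : SimpleGraph V} {x y : V} {s : Fin 4 → ℕ → V} {l : Fin 4 → ℕ}

lemma dist_eq (h : IsThetaLabelling G x y s l) {i m : Fin 4} (hmin : ∀ j, j ≠ i → l m ≤ l j)
    {p : ℕ} (hp : p ≤ l i) (j : Fin 4) {t : ℕ} (ht : t ≤ l j) :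
    G.dist (s i p) (s j t) = if j = i then thetaDistSame (l i) (l m) p t
      else thetaDistOther (l i) (l m) (l j) p t := by
  have hG := h.connected
  apply le_antisymm
  · have h1 := h.dist_start_le i hp
    have h2 := h.dist_finish_le i hp
    have h3 := h.dist_start_le j ht
    have h4 := h.dist_finish_le j ht
    have h5 := h.dist_start_finish_le m
    have h6 := hG.dist_triangle (u := s i p) (v := x) (w := s j t)
    have h7 := hG.dist_triangle (u := s i p) (v := y) (w := s j t)
    have h8 := hG.dist_triangle (u := s i p) (v := x) (w := y)
    have h9 := hG.dist_triangle (u := s i p) (v := y) (w := x)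
    rw [SimpleGraph.dist_comm (u := y) (v := x)] at h9
    rw [SimpleGraph.dist_comm (u := s i p) (v := x)] at h6 h8 h9
    rw [SimpleGraph.dist_comm (u := s i p) (v := y)] at h7 h8 h9
    split_ifs with hj
    · subst hj
      have h10 : G.dist (s j p) (s j t) ≤ (t - p) + (p - t) := by
        rcases le_total p t with hpt | hpt
        · have := h.dist_le_sub j hpt ht
          omega
        · have := h.dist_le_sub j hpt hp
          rw [SimpleGraph.dist_comm]
          omega
      unfold thetaDistSame
      omega
    · unfold thetaDistOther
      omega
  · obtain ⟨f, hf⟩ := h.exists_label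
      (fun j t => if j = i then thetaDistSame (l i) (l m) p t
        else thetaDistOther (l i) (l m) (l j) p t)
      (min p (l i - p + l m)) (min (l i - p) (p + l m))
      (fun j => by
        unfold thetaDistSame thetaDistOther
        split_ifs with hj
        · subst hj; omega
        · have := hmin j hj; omega)
      (fun j => by
        unfold thetaDistSame thetaDistOther
        split_ifs with hj
        · subst hj; omega
        · have := hmin j hj; omega)
    rw [← hf j t ht]
    refine hG.le_dist_of_lipschitz f (fun a b hab => ?_) ?_ _
    · obtain ⟨k, r, hr, ⟨rfl, rfl⟩ | ⟨rfl, rfl⟩⟩ := h.edge a b hab <;>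
      · rw [hf _ _ hr.le, hf _ _ hr]
        unfold thetaDistSame thetaDistOther
        split_ifs with hk
        · subst hk; omega
        · omega
    · rw [hf _ _ hp]
      simp [thetaDistSame]

lemma sum_univ [Fintype V] (h : IsThetaLabelling G x y s l) (f : V → ℤ) :
    ∑ w, f w = f x + f y + ∑ j, ∑ t ∈ Finset.Ico 1 (l j), f (s j t) := by
  classical
  have hxy : x ≠ y := by
    intro e
    have := h.inj 0 0 0 (l 0) (Nat.zero_le _) le_rfl (by rw [h.start, h.finish, e])
    have := h.pos 0
    omega
  set S : Finset V := (Finset.univ.sigma fun j => Finset.Ico 1 (l j)).image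
    fun z : (_ : Fin 4) × ℕ => s z.1 z.2 with hS
  have hsum : ∑ w ∈ S, f w = ∑ j, ∑ t ∈ Finset.Ico 1 (l j), f (s j t) := by
    rw [hS, Finset.sum_image, Finset.sum_sigma]
    rintro ⟨j, t⟩ hz ⟨j', t'⟩ hz' e
    simp only [Finset.coe_sigma, Set.mem_sigma_iff, Finset.coe_Ico, Set.mem_Ico] at hz hz'
    rcases h.inj j j' t t' hz.2.2.le hz'.2.2.le e with ⟨rfl, rfl⟩ | h1 | h1
    · rfl
    · omega
    · omega
  have hyS : y ∉ S := by
    simp only [hS, Finset.mem_image, Finset.mem_sigma, Finset.mem_Ico, not_exists, not_and]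
    rintro ⟨j, t⟩ ⟨-, h1, h2⟩ e
    have := h.inj j j t (l j) h2.le le_rfl (by rw [h.finish]; exact e)
    simp only at h1 h2
    omega
  have hxS : x ∉ insert y S := by
    simp only [Finset.mem_insert, hxy, false_or, hS, Finset.mem_image, Finset.mem_sigma,
      Finset.mem_Ico, not_exists, not_and]
    rintro ⟨j, t⟩ ⟨-, h1, h2⟩ e
    have := h.inj j j t 0 h2.le (Nat.zero_le _) (by rw [h.start]; exact e)
    simp only at h1 h2
    omega
  have huniv : (Finset.univ : Finset V) = insert x (insert y S) := by
    ext v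
    simp only [Finset.mem_univ, Finset.mem_insert, true_iff]
    obtain ⟨j, t, ht, rfl⟩ := h.cover v
    rcases Nat.eq_zero_or_pos t with rfl | h0
    · exact .inl (h.start j)
    rcases ht.eq_or_lt with rfl | h1
    · exact .inr (.inl (h.finish j))
    · refine .inr (.inr (Finset.mem_image.2 ⟨⟨j, t⟩, ?_, rfl⟩))
      simp only [Finset.mem_sigma, Finset.mem_univ, Finset.mem_Ico, true_and]
      omega
  rw [huniv, Finset.sum_insert hxS, Finset.sum_insert hyS, hsum, add_assoc]

end IsThetaLabelling

/-- `1`, `0` or `-1` according to whether `a < b`, `a = b` or `b < a`. -/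
def closerSign (a b : ℕ) : ℤ := (if a < b then 1 else 0) - (if b < a then 1 else 0)

lemma nC_sub_nC {V : Type*} [Fintype V] (G : SimpleGraph V) (u v : V) :
    (nC G u v : ℤ) - nC G v u = ∑ w, closerSign (G.dist u w) (G.dist v w) := by
  simp only [nC, closerSign, Finset.card_filter, Finset.sum_sub_distrib]
  push_cast
  congr

lemma Finset.sum_Ico_eq_of_const {g : ℕ → ℤ} {a b : ℕ} {c : ℤ} (hab : a ≤ b)
    (hg : ∀ t, a ≤ t → t < b → g t = c) : ∑ t ∈ Finset.Ico a b, g t = c * (b - a) := by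
  rw [Finset.sum_congr rfl fun t ht => hg t (Finset.mem_Ico.1 ht).1 (Finset.mem_Ico.1 ht).2]
  simp only [Finset.sum_const, Nat.card_Ico, nsmul_eq_mul, Nat.cast_sub hab]
  ring

lemma closerSign_eq_one {a b : ℕ} (h : a < b) : closerSign a b = 1 := by
  simp [closerSign, h, h.le]

lemma closerSign_eq_zero {a b : ℕ} (h : a = b) : closerSign a b = 0 := by
  simp [closerSign, h]

lemma closerSign_eq_neg_one {a b : ℕ} (h : b < a) : closerSign a b = -1 := by
  simp [closerSign, h, h.le]

/-- A sum of signs that are `1`, then `0`, then `-1`. -/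
lemma sum_closerSign_antitone {f g : ℕ → ℕ} {a α β b : ℕ} (h1 : a ≤ α) (h2 : α ≤ β) (h3 : β ≤ b)
    (hα : ∀ t, a ≤ t → t < α → f t < g t) (hβ : ∀ t, α ≤ t → t < β → f t = g t)
    (hb : ∀ t, β ≤ t → t < b → g t < f t) :
    ∑ t ∈ Finset.Ico a b, closerSign (f t) (g t) = α + β - a - b := by
  rw [← Finset.sum_Ico_consecutive _ (h1.trans h2) h3, ← Finset.sum_Ico_consecutive _ h1 h2,
    Finset.sum_Ico_eq_of_const h1 fun t ht ht' => closerSign_eq_one (hα t ht ht'),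
    Finset.sum_Ico_eq_of_const h2 fun t ht ht' => closerSign_eq_zero (hβ t ht ht'),
    Finset.sum_Ico_eq_of_const h3 fun t ht ht' => closerSign_eq_neg_one (hb t ht ht')]
  ring

lemma closerSign_comm (a b : ℕ) : closerSign a b = -closerSign b a := by
  simp [closerSign]

section Sums

variable {a b c p q : ℕ}

lemma sum_other_of_lt (ha : a = p + q + 1) (hpq : p ≤ q) (hbc : b ≤ c) (h : q < p + b) :
    ∑ t ∈ Finset.Ico 1 c, closerSign (thetaDistOther a b c p t) (thetaDistOther a b c (p + 1) t) =
      q - p := by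
  rw [sum_closerSign_antitone (α := (c + (q - p) + 1) / 2) (β := (c + (q - p)) / 2 + 1)]
  · omega
  · omega
  · omega
  · omega
  all_goals
    intro t _ _
    unfold thetaDistOther
    omega

lemma sum_other_of_eq (ha : a = p + q + 1) (hb : 1 ≤ b) (hbc : b ≤ c) (h : q = p + b) :
    ∑ t ∈ Finset.Ico 1 c, closerSign (thetaDistOther a b c p t) (thetaDistOther a b c (p + 1) t) =
      (min c ((c + b + 1) / 2) : ℕ) - 1 := by
  rw [sum_closerSign_antitone (α := min c ((c + b + 1) / 2)) (β := c)]
  · omega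
  · omega
  · omega
  · omega
  all_goals
    intro t _ _
    unfold thetaDistOther
    omega

lemma sum_other_of_gt (ha : a = p + q + 1) (hb : 1 ≤ b) (hbc : b ≤ c) (h : p + b < q) :
    ∑ t ∈ Finset.Ico 1 c, closerSign (thetaDistOther a b c p t) (thetaDistOther a b c (p + 1) t) =
      c - 1 := by
  rw [sum_closerSign_antitone (α := c) (β := c)]
  · omega
  · omega
  · omega
  · omega
  all_goals
    intro t _ _
    unfold thetaDistOther
    omega

lemma thetaDistSame_of_le {t : ℕ} (hpt : p ≤ t) (hta : t ≤ a) :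
    thetaDistSame a b p t = min (t - p) (p + b + (a - t)) := by
  unfold thetaDistSame
  omega

/-- The sum of the signs over the path carrying the edge, both ends included. -/
lemma sum_same (ha : a = p + q + 1) (hpq : p ≤ q) (hb : 1 ≤ b) :
    ∑ t ∈ Finset.Ico 0 (a + 1),
      closerSign (thetaDistSame a b p t) (thetaDistSame a b (p + 1) t) =
      if p + b ≤ q then 1 - (b : ℤ) else p - q := by
  have hfst : ∑ t ∈ Finset.Ico 0 (p + 1),
      closerSign (thetaDistSame a b p t) (thetaDistSame a b (p + 1) t) = p + 1 := by
    rw [Finset.sum_Ico_eq_of_const (c := 1) (Nat.zero_le _)]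
    · push_cast
      ring
    · intro t _ _
      apply closerSign_eq_one
      unfold thetaDistSame
      omega
  rw [← Finset.sum_Ico_consecutive _ (Nat.zero_le (p + 1)) (by omega), hfst]
  simp only [closerSign_comm (thetaDistSame a b p _), Finset.sum_neg_distrib]
  by_cases h : p + b ≤ q
  · rw [if_pos h, sum_closerSign_antitone (α := (3 * p + q + b + 3) / 2)
      (β := (3 * p + q + b + 2) / 2 + 1)]
    · omega
    · omega
    · omega
    · omega
    all_goals
      intro t _ _
      rw [thetaDistSame_of_le (by omega) (by omega), thetaDistSame_of_le (by omega) (by omega)]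
      omega
  · rw [if_neg h, sum_closerSign_antitone (α := a + 1) (β := a + 1)]
    · omega
    · omega
    · omega
    · omega
    all_goals
      intro t _ _
      rw [thetaDistSame_of_le (by omega) (by omega), thetaDistSame_of_le (by omega) (by omega)]
      omega

end Sums

namespace IsThetaLabelling

variable {V : Type*} {G : SimpleGraph V} {x y : V} {s : Fin 4 → ℕ → V} {l : Fin 4 → ℕ}

/-- For an edge in the half of its path nearer to `x`, the difference vanishes if it is the middle
edge and is at least `2` otherwise. -/
lemma nC_sub_nC_of_le [Fintype V] (h : IsThetaLabelling G x y s l) {i : Fin 4} {p q : ℕ}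
    (hl : l i = p + q + 1) (hpq : p ≤ q) :
    (p = q → (nC G (s i p) (s i (p + 1)) : ℤ) - nC G (s i (p + 1)) (s i p) = 0) ∧
    (p < q → 2 ≤ (nC G (s i p) (s i (p + 1)) : ℤ) - nC G (s i (p + 1)) (s i p)) := by
  obtain ⟨m, hm, hmin⟩ := Finset.exists_min_image (Finset.univ.erase i) l
    (Finset.card_pos.1 (by simp))
  have hmi : m ≠ i := Finset.ne_of_mem_erase hm
  replace hmin : ∀ j, j ≠ i → l m ≤ l j := fun j hj => hmin j (by simp [hj])
  obtain ⟨c, d, hci, hdi, hmc, hmd, hcd, huniv⟩ : ∃ c d : Fin 4, c ≠ i ∧ d ≠ i ∧ m ≠ c ∧ m ≠ d ∧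
      c ≠ d ∧ Finset.univ = {i, m, c, d} := by
    clear hmin hm h hl
    decide +revert
  set f := fun w => closerSign (G.dist (s i p) w) (G.dist (s i (p + 1)) w) with hf
  have hsame : ∀ t ≤ l i, f (s i t) =
      closerSign (thetaDistSame (l i) (l m) p t) (thetaDistSame (l i) (l m) (p + 1) t) := by
    intro t ht
    simp only [hf]
    rw [h.dist_eq hmin (by omega) i ht, h.dist_eq hmin (by omega) i ht, if_pos rfl, if_pos rfl]
  have hother : ∀ j ≠ i, ∑ t ∈ Finset.Ico 1 (l j), f (s j t) = ∑ t ∈ Finset.Ico 1 (l j),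
      closerSign (thetaDistOther (l i) (l m) (l j) p t)
        (thetaDistOther (l i) (l m) (l j) (p + 1) t) := by
    intro j hj
    refine Finset.sum_congr rfl fun t ht => ?_
    have ht := (Finset.mem_Ico.1 ht).2.le
    simp only [hf]
    rw [h.dist_eq hmin (by omega) j ht, h.dist_eq hmin (by omega) j ht, if_neg hj, if_neg hj]
  have hpath : f x + f y + ∑ t ∈ Finset.Ico 1 (l i), f (s i t) =
      ∑ t ∈ Finset.Ico 0 (l i + 1),
        closerSign (thetaDistSame (l i) (l m) p t) (thetaDistSame (l i) (l m) (p + 1) t) := by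
    rw [← Finset.sum_congr rfl fun t ht => hsame t (Nat.lt_succ_iff.1 (Finset.mem_Ico.1 ht).2),
      Finset.sum_Ico_succ_top (Nat.zero_le _), Finset.sum_eq_sum_Ico_succ_bot (h.pos i),
      h.start, h.finish]
    ring
  have hsum : (nC G (s i p) (s i (p + 1)) : ℤ) - nC G (s i (p + 1)) (s i p) =
      (f x + f y + ∑ t ∈ Finset.Ico 1 (l i), f (s i t)) +
        (∑ t ∈ Finset.Ico 1 (l m), f (s m t) + ∑ t ∈ Finset.Ico 1 (l c), f (s c t) +
          ∑ t ∈ Finset.Ico 1 (l d), f (s d t)) := by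
    rw [nC_sub_nC, h.sum_univ, huniv, Finset.sum_insert, Finset.sum_insert, Finset.sum_insert,
      Finset.sum_singleton]
    · ring
    · simp [hcd]
    · simp [hmc, hmd]
    · simp [hmi.symm, hci.symm, hdi.symm]
  rw [hsum, hpath, hother m hmi, hother c hci, hother d hdi, sum_same hl hpq (h.pos m)]
  have h1 := h.pos m
  have h2 := hmin c hci
  have h3 := hmin d hdi
  have h4 := h.two_le m c hmc
  have h5 := h.two_le m d hmd
  rcases lt_trichotomy q (p + l m) with hlt | heq | hgt
  · rw [sum_other_of_lt hl hpq le_rfl hlt, sum_other_of_lt hl hpq h2 hlt,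
      sum_other_of_lt hl hpq h3 hlt, if_neg (by omega)]
    omega
  · rw [sum_other_of_eq hl h1 le_rfl heq, sum_other_of_eq hl h1 h2 heq,
      sum_other_of_eq hl h1 h3 heq, if_pos (by omega)]
    omega
  · rw [sum_other_of_gt hl h1 le_rfl hgt, sum_other_of_gt hl h1 h2 hgt,
      sum_other_of_gt hl h1 h3 hgt, if_pos (by omega)]
    omega

lemma abs_nC_sub_nC_le_one_iff [Fintype V] (h : IsThetaLabelling G x y s l) {i : Fin 4} {p : ℕ}
    (hp : p < l i) :
    |(nC G (s i p) (s i (p + 1)) : ℤ) - nC G (s i (p + 1)) (s i p)| ≤ 1 ↔ l i = 2 * p + 1 := by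
  obtain ⟨q, hq⟩ : ∃ q, l i = p + q + 1 := ⟨l i - p - 1, by omega⟩
  rw [abs_le]
  rcases le_total p q with hpq | hpq
  · have := h.nC_sub_nC_of_le hq hpq
    omega
  · have := h.reverse.nC_sub_nC_of_le (i := i) (p := q) (q := p) (by omega) hpq
    rw [show l i - (q + 1) = p by omega, show l i - q = p + 1 by omega] at this
    omega

end IsThetaLabelling

lemma SimpleGraph.Walk.eq_of_length_eq_one {V : Type*} {G : SimpleGraph V} {x y : V}
    {P Q : G.Walk x y} (hP : P.length = 1) (hQ : Q.length = 1) : P = Q := by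
  refine P.ext_getVert_le_length (hP.trans hQ.symm) fun k hk => ?_
  rcases Nat.le_one_iff_eq_zero_or_eq_one.1 (hP ▸ hk) with rfl | rfl
  · simp
  · conv_lhs => rw [← hP]
    conv_rhs => rw [← hQ]
    simp

lemma IntDisj.symm {V : Type*} {G : SimpleGraph V} {x y x' y' : V}
    {P : G.Walk x y} {Q : G.Walk x' y'} (h : IntDisj P Q) : IntDisj Q P :=
  fun v hQ hP => (h v hP hQ).symm

lemma SimpleGraph.Walk.IsPath.eq_of_getVert_eq {V : Type*} {G : SimpleGraph V} {x y : V}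
    {P : G.Walk x y} (hP : P.IsPath) {t t' : ℕ} (ht : t ≤ P.length) (ht' : t' ≤ P.length)
    (h : P.getVert t = P.getVert t') : t = t' :=
  hP.getVert_injOn ht ht' h

lemma isThetaLabelling_getVert {V : Type*} {G : SimpleGraph V} {x y : V} (hxy : x ≠ y)
    (Q : Fin 4 → G.Walk x y) (hpath : ∀ j, (Q j).IsPath) (hne : ∀ j j', j ≠ j' → Q j ≠ Q j')
    (hdisj : ∀ j j', j ≠ j' → IntDisj (Q j) (Q j')) (hcover : ∀ v, ∃ j, v ∈ (Q j).support)
    (hedge : ∀ e ∈ G.edgeSet, ∃ j, e ∈ (Q j).edges) :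
    IsThetaLabelling G x y (fun j => (Q j).getVert) fun j => (Q j).length := by
  have hpos : ∀ j, 1 ≤ (Q j).length := fun j =>
    Nat.one_le_iff_ne_zero.2 fun h => hxy (SimpleGraph.Walk.eq_of_length_eq_zero h)
  refine ⟨fun j => by simp, fun j => by simp, hpos, fun j j' hj => ?_,
    fun j j' t t' ht ht' e => ?_, fun v => ?_, fun j t ht => (Q j).adj_getVert_succ ht,
    fun a b hab => ?_⟩
  · by_contra! hlt
    have h1 := hpos j
    have h2 := hpos j'
    exact hne j j' hj (SimpleGraph.Walk.eq_of_length_eq_one (by omega) (by omega))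
  · by_cases hj : j = j'
    · subst hj
      exact .inl ⟨rfl, (hpath j).eq_of_getVert_eq ht ht' e⟩
    · right
      rcases (hdisj j j' hj _ ((Q j).getVert_mem_support t)
        (e ▸ (Q j').getVert_mem_support t')).1 with hv | hv
      · exact .inl ⟨(hpath j).eq_of_getVert_eq ht (Nat.zero_le _) (by simpa using hv),
          (hpath j').eq_of_getVert_eq ht' (Nat.zero_le _) (by simpa using e.symm.trans hv)⟩
      · exact .inr ⟨(hpath j).eq_of_getVert_eq ht le_rfl (by simpa using hv),
          (hpath j').eq_of_getVert_eq ht' le_rfl (by simpa using e.symm.trans hv)⟩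
  · obtain ⟨j, hv⟩ := hcover v
    obtain ⟨t, e, ht⟩ := SimpleGraph.Walk.mem_support_iff_exists_getVert.1 hv
    exact ⟨j, t, ht, e⟩
  · obtain ⟨j, he⟩ := hedge s(a, b) hab
    obtain ⟨t, ht, e⟩ := List.getElem_of_mem he
    rw [SimpleGraph.Walk.getElem_edges] at e
    refine ⟨j, t, by simpa using ht, ?_⟩
    rcases Sym2.eq_iff.1 e with ⟨h1, h2⟩ | ⟨h1, h2⟩
    · exact .inl ⟨h1.symm, h2.symm⟩
    · exact .inr ⟨h1.symm, h2.symm⟩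

lemma Theta1Cond.isThetaLabelling {V : Type*} {G : SimpleGraph V} {x y : V}
    {P₁ P₂ P₃ P₄ : G.Walk x y} (hΘ : Theta1Cond G x y P₁ P₂ P₃ P₄) :
    IsThetaLabelling G x y (fun j => (![P₁, P₂, P₃, P₄] j).getVert)
      fun j => (![P₁, P₂, P₃, P₄] j).length := by
  obtain ⟨hxy, p1, p2, p3, p4, -, -, -, -, n12, n13, n14, n23, n24, n34,
    d12, d13, d14, d23, d24, d34, hv, he⟩ := hΘ
  refine isThetaLabelling_getVert hxy _ ?_ ?_ ?_ ?_ ?_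
  · simp [Fin.forall_fin_succ, *]
  · simp [Fin.forall_fin_succ, n12, n13, n14, n23, n24, n34, n12.symm, n13.symm, n14.symm,
      n23.symm, n24.symm, n34.symm]
  · simp [Fin.forall_fin_succ, d12, d13, d14, d23, d24, d34, d12.symm, d13.symm, d14.symm,
      d23.symm, d24.symm, d34.symm]
  · simpa [Fin.exists_fin_succ] using hv
  · simpa only [Fin.exists_fin_succ, Matrix.cons_val_zero, Matrix.cons_val_succ,
      IsEmpty.exists_iff, or_false] using he

/-- In a Θ₁-graph with branch vertices `x, y` and paths `P₁, P₂, P₃, P₄`, an edge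
`e = uv` satisfies `|n_u(e) − n_v(e)| ≤ 1` iff `e` is the middle edge of one of the
four paths of odd length. -/
theorem theta1_diff_le_one_iff {V : Type*} [Fintype V] {G : SimpleGraph V}
    {x y : V} {P₁ P₂ P₃ P₄ : G.Walk x y} (hΘ : Theta1Cond G x y P₁ P₂ P₃ P₄)
    (u v : V) (he : G.Adj u v) :
    |(nC G u v : ℤ) - (nC G v u : ℤ)| ≤ 1 ↔
      ∃ P ∈ [P₁, P₂, P₃, P₄], ∃ k : ℕ,
        P.length = 2 * k + 1 ∧ P.edges[k]? = some s(u, v) := by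
  have h := hΘ.isThetaLabelling
  have hmem : ∀ P, P ∈ [P₁, P₂, P₃, P₄] ↔ ∃ j, ![P₁, P₂, P₃, P₄] j = P := by
    intro P
    simp [Fin.exists_fin_succ, eq_comm]
  constructor
  · intro hle
    obtain ⟨j, t, ht, huv⟩ := h.edge u v he
    have hedge : (![P₁, P₂, P₃, P₄] j).edges[t]? = some s(u, v) := by
      rw [List.getElem?_eq_getElem (by simpa using ht), SimpleGraph.Walk.getElem_edges,
        Option.some_inj, Sym2.eq_iff]
      rcases huv with ⟨h1, h2⟩ | ⟨h1, h2⟩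
      · exact .inl ⟨h1.symm, h2.symm⟩
      · exact .inr ⟨h1.symm, h2.symm⟩
    refine ⟨_, (hmem _).2 ⟨j, rfl⟩, t, (h.abs_nC_sub_nC_le_one_iff ht).1 ?_, hedge⟩
    rcases huv with ⟨rfl, rfl⟩ | ⟨rfl, rfl⟩
    · exact hle
    · rwa [abs_sub_comm]
  · rintro ⟨P, hP, k, hk, hedge⟩
    obtain ⟨j, rfl⟩ := (hmem P).1 hP
    have ht : k < (![P₁, P₂, P₃, P₄] j).length := by omega
    have hle := (h.abs_nC_sub_nC_le_one_iff ht).2 hk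
    rw [List.getElem?_eq_getElem (by simpa using ht), SimpleGraph.Walk.getElem_edges,
      Option.some_inj, Sym2.eq_iff] at hedge
    rcases hedge with ⟨rfl, rfl⟩ | ⟨rfl, rfl⟩
    · exact hle
    · rwa [abs_sub_comm]
end
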